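/- arXiv:2401.18060 — 2 statements merged into one kernel-verified Lean document; each statement's English description precedes it below -/
import Mathlib

section
/- For every fixed real number ε₁ > 0, the proportion of numerical semigroups S of genus g whose multiplicity m(S) satisfies (γ − ε₁)·g < m(S) < (γ + ε₁)·g, among all numerical semigroups of genus g, tends to 1 as g → ∞. That is, with A_g^m(ε₁) = {S of genus g : (γ − ε₁)g < m(S) < (γ + ε₁)g}, one has lim_{g→∞} #A_g^m(ε₁)/n_g = 1. -/
/-- A numerical semigroup: an additive submonoid of ℕ with finite complement. -/
structure NumericalSemigroup where
  carrier : Set ℕ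
  zero_mem : 0 ∈ carrier
  add_mem : ∀ ⦃a b : ℕ⦄, a ∈ carrier → b ∈ carrier → a + b ∈ carrier
  cofinite : (carrierᶜ : Set ℕ).Finite

namespace NumericalSemigroup

/-- The genus: the number of gaps. -/
noncomputable def genus (S : NumericalSemigroup) : ℕ := S.carrierᶜ.ncard

/-- The multiplicity: the smallest nonzero element. -/
noncomputable def multiplicity (S : NumericalSemigroup) : ℕ :=
  sInf {n : ℕ | n ∈ S.carrier ∧ n ≠ 0}

/-- The Frobenius number: the largest gap. -/
noncomputable def frobenius (S : NumericalSemigroup) : ℕ := sSup S.carrierᶜ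

/-- The left elements: the elements of `S` smaller than the Frobenius number. -/
def leftElements (S : NumericalSemigroup) : Set ℕ :=
  {s : ℕ | s ∈ S.carrier ∧ s < S.frobenius}

end NumericalSemigroup

/-- The gcd of a set of natural numbers: the common divisor that is divisible by
every common divisor (so `setGcd ∅ = 0`). -/
noncomputable def setGcd (A : Set ℕ) : ℕ :=
  sInf {d : ℕ | (∀ a ∈ A, d ∣ a) ∧ ∀ e : ℕ, (∀ a ∈ A, e ∣ a) → e ∣ d}

/-- The constant γ = (5 + √5)/10. -/
noncomputable def gamma : ℝ := (5 + Real.sqrt 5) / 10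

/-- `S` belongs to an infinite chain in the semigroup tree. -/
def InInfiniteChain (S : NumericalSemigroup) : Prop :=
  ∃ f : ℕ → NumericalSemigroup, f 0 = S ∧
    ∀ i : ℕ, (f (i + 1)).carrier ≠ Set.univ ∧
      (f i).carrier = (f (i + 1)).carrier ∪ {(f (i + 1)).frobenius}

section ProductMeasure

open MeasureTheory Finset
open scoped ENNReal

theorem DependsOn.lmarginal {ι Ω : Type*} [DecidableEq ι] [MeasurableSpace Ω] (μ : Measure Ω)
    {f : (ι → Ω) → ℝ≥0∞} {c : Set ι} (hf : DependsOn f c)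
    (s : Finset ι) : DependsOn (∫⋯∫⁻_s, f ∂fun _ => μ) c := by
  intro x y hxy
  unfold MeasureTheory.lmarginal
  congr 1
  ext z
  apply hf
  intro i hi
  simp only [Function.updateFinset]
  split_ifs
  · rfl
  · exact hxy i hi

variable {ι κ Ω : Type*} [Fintype ι] [DecidableEq ι] [Fintype Ω] [MeasurableSpace Ω]
  [MeasurableSingletonClass Ω] (μ : Measure Ω) [IsProbabilityMeasure μ]

theorem lmarginal_eq_of_dependsOn {f : (ι → Ω) → ℝ≥0∞} {c : Set ι} (hf : DependsOn f c)
    {s t : Finset ι} (hts : t ⊆ s) (hc : ∀ i ∈ s, i ∈ c → i ∈ t) :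
    ∫⋯∫⁻_s, f ∂(fun _ => μ) = ∫⋯∫⁻_t, f ∂(fun _ => μ) := by
  have hm : Measurable f := Measurable.of_discrete
  conv_lhs => rw [← sdiff_union_of_subset hts, lmarginal_union _ f hm sdiff_disjoint]
  ext x
  have : ∀ y : (∀ _ : (s \ t : Finset ι), Ω),
      (∫⋯∫⁻_t, f ∂(fun _ => μ)) (Function.updateFinset x (s \ t) y)
        = (∫⋯∫⁻_t, f ∂(fun _ => μ)) x := by
    intro y
    apply hf.lmarginal μ t
    intro i hi
    simp only [Function.updateFinset]
    split_ifs with h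
    · simp only [mem_sdiff] at h
      exact absurd (hc i h.1 hi) h.2
    · rfl
  change ∫⁻ y, (∫⋯∫⁻_t, f ∂(fun _ => μ)) (Function.updateFinset x (s \ t) y)
    ∂(Measure.pi fun _ : (s \ t : Finset ι) => μ) = _
  simp [this]

/-- Finner's inequality: a Hölder inequality for functions on a product probability space each
of which depends on few coordinates. -/
theorem lmarginal_prod_rpow_le (A : Finset κ) (f : κ → (ι → Ω) → ℝ≥0∞) (c : κ → Finset ι)
    (hf : ∀ j ∈ A, DependsOn (f j) (c j)) {p : ℝ} (hp : 0 ≤ p) (s : Finset ι)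
    (hs : ∀ u ∈ s, (#{j ∈ A | u ∈ c j} : ℝ) * p ≤ 1) (x : ι → Ω) :
    (∫⋯∫⁻_s, (fun k => ∏ j ∈ A, f j k ^ p) ∂(fun _ => μ)) x
      ≤ ∏ j ∈ A, (∫⋯∫⁻_s, f j ∂(fun _ => μ)) x ^ p := by
  induction s using Finset.induction generalizing x with
  | empty => simp
  | insert u s hu ih =>
    have ih' := ih (fun v hv => hs v (mem_insert_of_mem hv))
    rw [lmarginal_insert _ Measurable.of_discrete hu]
    set F : κ → Ω → ℝ≥0∞ := fun j a =>
      (∫⋯∫⁻_s, f j ∂(fun _ => μ)) (Function.update x u a) with hF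
    have h1 : ∀ j ∈ A, (∫⋯∫⁻_insert u s, f j ∂(fun _ => μ)) x = ∫⁻ a, F j a ∂μ := by
      intro j _
      rw [lmarginal_insert _ Measurable.of_discrete hu]
    rw [prod_congr rfl fun j hj => by rw [h1 j hj]]
    have h2 : ∀ j ∈ A, u ∉ c j → ∀ a, F j a = (∫⋯∫⁻_s, f j ∂(fun _ => μ)) x := by
      intro j hj hju a
      apply (hf j hj).lmarginal μ s
      intro i hi
      rw [Function.update_of_ne]
      rintro rfl
      exact hju hi
    calc _ ≤ ∫⁻ a, ∏ j ∈ A, F j a ^ p ∂μ := lintegral_mono fun a => ih' _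
      _ = ∫⁻ a, (∏ j ∈ A with u ∉ c j, (∫⋯∫⁻_s, f j ∂(fun _ => μ)) x ^ p) *
            ((1 : ℝ≥0∞) ^ (1 - #{j ∈ A | u ∈ c j} * p) *
              ∏ j ∈ A with u ∈ c j, F j a ^ p) ∂μ := by
          congr 1
          ext a
          rw [ENNReal.one_rpow, one_mul, ← prod_filter_not_mul_prod_filter A (fun j => u ∈ c j)]
          congr 1
          apply prod_congr rfl
          intro j hj
          rw [mem_filter] at hj
          rw [h2 j hj.1 hj.2]
      _ = (∏ j ∈ A with u ∉ c j, (∫⋯∫⁻_s, f j ∂(fun _ => μ)) x ^ p) *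
            ∫⁻ a, ((1 : ℝ≥0∞) ^ (1 - #{j ∈ A | u ∈ c j} * p) *
              ∏ j ∈ A with u ∈ c j, F j a ^ p) ∂μ :=
          lintegral_const_mul _ Measurable.of_discrete
      _ ≤ (∏ j ∈ A with u ∉ c j, (∫⁻ a, F j a ∂μ) ^ p) *
            ((∫⁻ _, 1 ∂μ) ^ (1 - #{j ∈ A | u ∈ c j} * p) *
              ∏ j ∈ A with u ∈ c j, (∫⁻ a, F j a ∂μ) ^ p) := by
          apply mul_le_mul'
          · apply le_of_eq
            apply prod_congr rfl
            intro j hj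
            rw [mem_filter] at hj
            simp [h2 j hj.1 hj.2]
          · apply ENNReal.lintegral_mul_prod_norm_pow_le _ aemeasurable_const
              (fun i _ => Measurable.of_discrete.aemeasurable)
            · simp
            · linarith [hs u (mem_insert_self u s)]
            · exact fun _ _ => hp
      _ = _ := by
          simp only [lintegral_const, measure_univ, mul_one, ENNReal.one_rpow, one_mul]
          rw [prod_filter_not_mul_prod_filter A (fun j => u ∈ c j)]

/-- Independent identically distributed letters attached to the vertices of a bipartite graph in
which each vertex of one side has three neighbours: a bound for the probability that all edges
satisfy `R`. -/
theorem pi_bipartite_le (L : Finset ι) (e : Fin 3 → ι → ι) (he : ∀ t, Set.InjOn (e t) L)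
    (heL : ∀ t, ∀ v ∈ L, e t v ∉ L) (hd : ∀ v ∈ L, Function.Injective fun t => e t v)
    (R : Ω → Ω → Prop) :
    Measure.pi (fun _ : ι => μ) {k | ∀ v ∈ L, ∀ t, R (k v) (k (e t v))} ≤
      ((∫⁻ c, (μ {b | ∀ t, R b (c t)}) ^ (3 : ℝ) ∂(Measure.pi fun _ : Fin 3 => μ)) ^ (1 / 3 : ℝ))
        ^ #L := by
  classical
  obtain ⟨x⟩ : Nonempty (ι → Ω) := by
    have : Nonempty Ω := nonempty_of_isProbabilityMeasure μ
    infer_instance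
  set f : ι → (ι → Ω) → ℝ≥0∞ := fun v k => if ∀ t, R (k v) (k (e t v)) then 1 else 0 with hf
  set N : ι → Finset ι := fun v => univ.image fun t => e t v with hN
  set F : ι → (ι → Ω) → ℝ≥0∞ := fun v k => μ {b | ∀ t, R b (k (e t v))} with hF
  have hmem : ∀ t v, e t v ∈ N v := fun t v => mem_image_of_mem _ (mem_univ t)
  have hfdep : ∀ v, DependsOn (f v) ((insert v (N v) : Finset ι) : Set ι) := by
    intro v k k' h
    simp only [hf]
    rw [h v (by simp)]
    congr 1
    ext
    apply forall_congr'
    intro t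
    rw [h (e t v) (by simp [hmem])]
  have hFdep : ∀ v, DependsOn (fun k => F v k ^ (3 : ℝ)) (N v : Set ι) := by
    intro v k k' h
    simp only [hF]
    congr 3
    ext b
    apply forall_congr'
    intro t
    rw [h (e t v) (by simp [hmem])]
  have hNL : ∀ v ∈ L, ∀ u ∈ L, u ∉ N v := by
    intro v hv u hu h
    simp only [hN, mem_image, mem_univ, true_and] at h
    obtain ⟨t, rfl⟩ := h
    exact heL t v hv hu
  have hEf : ∀ v ∈ L, (∫⋯∫⁻_L, f v ∂(fun _ => μ)) = F v := by
    intro v hv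
    rw [lmarginal_eq_of_dependsOn μ (hfdep v) (t := {v}) (by simpa using hv), lmarginal_singleton]
    · ext k
      have h0 : ∀ a, f v (Function.update k v a) =
          Set.indicator {b | ∀ t, R b (k (e t v))} (fun _ => 1) a := by
        intro a
        have : ∀ t, e t v ≠ v := fun t h => heL t v hv (by rwa [h])
        simp [hf, Set.indicator, this]
      simp only [h0]
      rw [lintegral_indicator_const (Set.toFinite _).measurableSet, one_mul]
    · intro u hu huc
      simp only [coe_insert, Set.mem_insert_iff, mem_coe] at huc
      rcases huc with rfl | huc
      · simp
      · exact absurd huc (hNL v hv u hu)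
  have hEF : ∀ v ∈ L, (∫⋯∫⁻_Lᶜ, (fun k => F v k ^ (3 : ℝ)) ∂(fun _ => μ)) x =
      ∫⁻ c, (μ {b | ∀ t, R b (c t)}) ^ (3 : ℝ) ∂(Measure.pi fun _ : Fin 3 => μ) := by
    intro v hv
    rw [lmarginal_eq_of_dependsOn μ (hFdep v) (t := N v)]
    · rw [lintegral_eq_lmarginal_univ (x ∘ fun t => e t v)]
      exact lmarginal_image (X := fun _ => Ω) (μ := fun _ => μ) (hd v hv) univ
        (f := fun c => (μ {b | ∀ t, R b (c t)}) ^ (3 : ℝ)) Measurable.of_discrete x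
    · intro u hu
      rw [mem_compl]
      exact fun h => hNL v hv u h hu
    · exact fun u _ h => h
  calc Measure.pi (fun _ : ι => μ) {k | ∀ v ∈ L, ∀ t, R (k v) (k (e t v))}
      = ∫⁻ k, ∏ v ∈ L, f v k ^ (1 : ℝ) ∂(Measure.pi fun _ : ι => μ) := by
        rw [← one_mul (Measure.pi _ _),
          ← lintegral_indicator_const (Set.toFinite _).measurableSet]
        congr 1
        ext k
        simp only [Set.indicator, Set.mem_ofPred_eq, hf, ENNReal.rpow_one]
        split_ifs with h
        · symm
          apply prod_eq_one
          intro v hv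
          rw [if_pos (h v hv)]
        · push Not at h
          obtain ⟨v, hv, t, ht⟩ := h
          symm
          apply prod_eq_zero hv
          rw [if_neg]
          exact fun h => ht (h t)
    _ = (∫⋯∫⁻_Lᶜ, ∫⋯∫⁻_L, (fun k => ∏ v ∈ L, f v k ^ (1 : ℝ)) ∂(fun _ => μ) ∂(fun _ => μ)) x := by
        rw [lintegral_eq_lmarginal_univ x, ← lmarginal_union _ _ Measurable.of_discrete
          disjoint_compl_left, ← sup_eq_union, compl_sup_eq_top, top_eq_univ]
    _ ≤ (∫⋯∫⁻_Lᶜ, (fun k => ∏ v ∈ L, (F v k ^ (3 : ℝ)) ^ (1 / 3 : ℝ)) ∂(fun _ => μ)) x := by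
        apply lmarginal_mono
        intro k
        refine (lmarginal_prod_rpow_le μ L f _ (fun v _ => hfdep v) zero_le_one L ?_ k).trans ?_
        · intro u hu
          rw [mul_one]
          norm_cast
          rw [card_le_one]
          have : ∀ v ∈ L, u ∈ insert v (N v) → u = v := by
            intro v hv h
            rcases mem_insert.1 h with h | h
            · exact h
            · exact absurd h (hNL v hv u hu)
          intro a ha b hb
          rw [mem_filter] at ha hb
          rw [← this a ha.1 ha.2, this b hb.1 hb.2]
        · apply le_of_eq
          apply prod_congr rfl
          intro v hv
          rw [hEf v hv, ← ENNReal.rpow_mul]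
          norm_num
    _ ≤ ∏ v ∈ L, (∫⋯∫⁻_Lᶜ, (fun k => F v k ^ (3 : ℝ)) ∂(fun _ => μ)) x ^ (1 / 3 : ℝ) := by
        apply lmarginal_prod_rpow_le μ L _ N (fun v _ => hFdep v) (by norm_num)
        intro u _
        have : #{v ∈ L | u ∈ N v} ≤ 3 := by
          calc #{v ∈ L | u ∈ N v} ≤ #(univ.biUnion fun t : Fin 3 => {v ∈ L | e t v = u}) := by
                apply card_le_card
                intro v hv
                simpa [hN] using hv
            _ ≤ ∑ t : Fin 3, #{v ∈ L | e t v = u} := card_biUnion_le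
            _ ≤ ∑ t : Fin 3, 1 := by
                apply sum_le_sum
                intro t _
                rw [card_le_one]
                intro a ha b hb
                rw [mem_filter] at ha hb
                exact he t ha.1 hb.1 (ha.2.trans hb.2.symm)
            _ = 3 := by simp
        have : (#{v ∈ L | u ∈ N v} : ℝ) ≤ 3 := by exact_mod_cast this
        linarith
    _ = _ := by
        rw [prod_congr rfl fun v hv => by rw [hEF v hv], prod_const]

end ProductMeasure

section WeightedWords

open MeasureTheory Finset
open scoped ENNReal

variable {ι Ω : Type*} [Fintype ι] [DecidableEq ι] [Fintype Ω]

open Classical in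
theorem sum_prod_bipartite_le_of_sum_eq_one (q : Ω → ℝ) (hq : ∀ a, 0 ≤ q a) (hq1 : ∑ a, q a = 1)
    (L : Finset ι) (e : Fin 3 → ι → ι) (he : ∀ t, Set.InjOn (e t) L)
    (heL : ∀ t, ∀ v ∈ L, e t v ∉ L) (hd : ∀ v ∈ L, Function.Injective fun t => e t v)
    (R : Ω → Ω → Prop) {β : ℝ} (hβ : 0 ≤ β)
    (hR : ∑ c : Fin 3 → Ω, (∏ t, q (c t)) * (∑ b with ∀ t, R b (c t), q b) ^ 3 ≤ β ^ 3) :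
    ∑ k : ι → Ω with ∀ v ∈ L, ∀ t, R (k v) (k (e t v)), ∏ i, q (k i) ≤ β ^ #L := by
  let _ : MeasurableSpace Ω := ⊤
  let μ : Measure Ω := ∑ a, ENNReal.ofReal (q a) • Measure.dirac a
  have hμ : ∀ P : Ω → Prop, μ {b | P b} = ENNReal.ofReal (∑ b with P b, q b) := by
    intro P
    rw [ENNReal.ofReal_sum_of_nonneg fun a _ => hq a, sum_filter]
    simp only [μ, Measure.finsetSum_apply, Measure.smul_apply, smul_eq_mul]
    apply sum_congr rfl
    intro a _
    rw [Measure.dirac_apply]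
    simp [Set.indicator]
  have hμs : ∀ a, μ {a} = ENNReal.ofReal (q a) := by
    intro a
    have := hμ (fun b => b = a)
    rw [Set.ofPred_eq_eq_singleton] at this
    rw [this, sum_filter]
    simp
  have : IsProbabilityMeasure μ := ⟨by
    have := hμ (fun _ => True)
    simpa [hq1] using this⟩
  have hpi : ∀ k : ι → Ω,
      Measure.pi (fun _ : ι => μ) {k} = ENNReal.ofReal (∏ i, q (k i)) := by
    intro k
    rw [Measure.pi_singleton, ENNReal.ofReal_prod_of_nonneg fun i _ => hq _]
    simp [hμs]
  have key := pi_bipartite_le μ L e he heL hd R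
  have h1 : ∫⁻ c, (μ {b | ∀ t, R b (c t)}) ^ (3 : ℝ) ∂(Measure.pi fun _ : Fin 3 => μ)
      ≤ ENNReal.ofReal (β ^ 3) := by
    rw [lintegral_fintype]
    refine le_trans (le_of_eq ?_) (ENNReal.ofReal_le_ofReal hR)
    rw [ENNReal.ofReal_sum_of_nonneg]
    · apply sum_congr rfl
      intro c _
      rw [Measure.pi_singleton, hμ, ENNReal.ofReal_mul (prod_nonneg fun t _ => hq _),
        ENNReal.ofReal_prod_of_nonneg fun i _ => hq _, mul_comm,
        ENNReal.ofReal_pow (sum_nonneg fun t _ => hq _)]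
      simp only [hμs]
      congr 1
      rw [show (3 : ℝ) = ((3 : ℕ) : ℝ) by norm_num, ENNReal.rpow_natCast]
      congr!
    · intro c _
      exact mul_nonneg (prod_nonneg fun t _ => hq _) (pow_nonneg (sum_nonneg fun t _ => hq _) _)
  have h2 : (∫⁻ c, (μ {b | ∀ t, R b (c t)}) ^ (3 : ℝ) ∂(Measure.pi fun _ : Fin 3 => μ))
      ^ (1 / 3 : ℝ) ≤ ENNReal.ofReal β := by
    refine (ENNReal.rpow_le_rpow h1 (by norm_num)).trans ?_
    rw [ENNReal.ofReal_pow hβ, ← ENNReal.rpow_natCast, ← ENNReal.rpow_mul]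
    norm_num
  have h3 : Measure.pi (fun _ : ι => μ) {k | ∀ v ∈ L, ∀ t, R (k v) (k (e t v))} =
      ENNReal.ofReal (∑ k : ι → Ω with ∀ v ∈ L, ∀ t, R (k v) (k (e t v)), ∏ i, q (k i)) := by
    rw [ENNReal.ofReal_sum_of_nonneg fun k _ => prod_nonneg fun i _ => hq _]
    simp_rw [← hpi]
    rw [sum_measure_singleton]
    congr 1
    ext k
    simp
  rw [h3] at key
  have h4 := key.trans (pow_le_pow_left' h2 _)
  rw [← ENNReal.ofReal_pow hβ] at h4
  exact (ENNReal.ofReal_le_ofReal_iff (pow_nonneg hβ _)).1 h4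

open Classical in
theorem sum_prod_bipartite_le (w : Ω → ℝ) (hw : ∀ a, 0 ≤ w a) (hW : 0 < ∑ a, w a)
    (L : Finset ι) (e : Fin 3 → ι → ι) (he : ∀ t, Set.InjOn (e t) L)
    (heL : ∀ t, ∀ v ∈ L, e t v ∉ L) (hd : ∀ v ∈ L, Function.Injective fun t => e t v)
    (R : Ω → Ω → Prop) {θ : ℝ}
    (hR : ∑ c : Fin 3 → Ω, (∏ t, w (c t)) * (∑ b with ∀ t, R b (c t), w b) ^ 3 ≤ θ ^ 6) :
    ∑ k : ι → Ω with ∀ v ∈ L, ∀ t, R (k v) (k (e t v)), ∏ i, w (k i) ≤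
      (∑ a, w a) ^ Fintype.card ι * (θ / ∑ a, w a) ^ (2 * #L) := by
  set W := ∑ a, w a with hWdef
  have key := sum_prod_bipartite_le_of_sum_eq_one (fun a => w a / W)
    (fun a => div_nonneg (hw a) hW.le) (by rw [← sum_div, ← hWdef, div_self hW.ne']) L e he heL hd R
    (β := (θ / W) ^ 2) (by positivity) (by
      calc _ = (∑ c : Fin 3 → Ω, (∏ t, w (c t)) * (∑ b with ∀ t, R b (c t), w b) ^ 3) / W ^ 6 := by
            rw [sum_div]
            apply sum_congr rfl
            intro c _
            rw [prod_div_distrib, ← sum_div, div_pow, div_mul_div_comm, prod_const]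
            simp [← pow_add]
        _ ≤ θ ^ 6 / W ^ 6 := by gcongr
        _ = _ := by rw [← pow_mul, div_pow])
  rw [← pow_mul] at key
  rw [← div_le_iff₀' (by positivity), sum_div]
  refine le_trans (le_of_eq ?_) key
  apply sum_congr rfl
  intro k _
  rw [prod_div_distrib, prod_const, card_univ]

end WeightedWords

section LetterEstimates

open Finset

theorem sum_pi_fin_three {Ω M : Type*} [Fintype Ω] [AddCommMonoid M] (f : (Fin 3 → Ω) → M) :
    ∑ c, f c = ∑ a, ∑ b, ∑ d, f ![a, b, d] := by
  rw [← Fintype.sum_prod_type' (f := fun a b => ∑ d, f ![a, b, d])]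
  rw [← Fintype.sum_prod_type' (f := fun (p : Ω × Ω) d => f ![p.1, p.2, d])]
  symm
  apply Fintype.sum_bijective fun p : (Ω × Ω) × Ω => ![p.1.1, p.1.2, p.2]
  · constructor
    · rintro ⟨⟨a, b⟩, d⟩ ⟨⟨a', b'⟩, d'⟩ h
      simpa [and_assoc] using h
    · intro c
      refine ⟨((c 0, c 1), c 2), ?_⟩
      ext i
      fin_cases i <;> rfl
  · intro _
    rfl

/-- The partition function of the complete bipartite graph `K₃,₃`, with vertices labelled by
`Fin K`, the label `a` having weight `x ^ (a + 1)`. -/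
def tripleWeight (K : ℕ) (x : ℝ) : ℝ :=
  ∑ c : Fin 3 → Fin K, (∏ t, x ^ ((c t : ℕ) + 1)) *
    (∑ b : Fin K with ∀ t, K ≤ (b : Fin K).val + c t + 2, x ^ ((b : ℕ) + 1)) ^ 3

theorem tripleWeight_mono (K : ℕ) {x y : ℝ} (hx : 0 ≤ x) (hxy : x ≤ y) :
    tripleWeight K x ≤ tripleWeight K y := by
  have hy := hx.trans hxy
  unfold tripleWeight
  gcongr

theorem tripleWeight_three : tripleWeight 3 (31 / 50) ≤ (491 / 500) ^ 6 := by
  unfold tripleWeight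
  rw [sum_pi_fin_three]
  simp [Fin.sum_univ_succ, sum_filter, Fin.forall_fin_succ, Fin.prod_univ_succ]
  norm_num

theorem tripleWeight_four : tripleWeight 4 (31 / 50) ≤ (491 / 500) ^ 6 := by
  unfold tripleWeight
  rw [sum_pi_fin_three]
  simp [Fin.sum_univ_succ, sum_filter, Fin.forall_fin_succ, Fin.prod_univ_succ]
  norm_num

theorem tripleWeight_le_cube (K : ℕ) {x : ℝ} (hx : 0 ≤ x) :
    tripleWeight K x ≤ (∑ a : Fin K, x ^ ((a : ℕ) + 1) *
      ∑ b : Fin K with K ≤ (b : Fin K).val + a + 2, x ^ ((b : ℕ) + 1)) ^ 3 := by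
  rw [Fintype.sum_pow]
  unfold tripleWeight
  gcongr with c _
  rw [prod_mul_distrib]
  gcongr
  calc (∑ b : Fin K with ∀ t, K ≤ (b : Fin K).val + c t + 2, x ^ ((b : ℕ) + 1)) ^ 3
      = ∏ t : Fin 3, ∑ b : Fin K with ∀ t, K ≤ (b : Fin K).val + c t + 2, x ^ ((b : ℕ) + 1) := by
        simp
    _ ≤ _ := by
      gcongr with t _
      exact fun h => h t

theorem pairWeight_five : (∑ a : Fin 5, (31 / 50 : ℝ) ^ ((a : ℕ) + 1) *
      ∑ b : Fin 5 with 5 ≤ (b : Fin 5).val + a + 2, (31 / 50 : ℝ) ^ ((b : ℕ) + 1)) ≤ 24 / 25 := by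
  simp [Fin.sum_univ_succ, sum_filter]
  norm_num

theorem pairWeight_le {K : ℕ} (hK : 1 ≤ K) {x : ℝ} (hx : 0 ≤ x) (hx1 : x < 1) :
    ∑ a : Fin K, x ^ ((a : ℕ) + 1) * ∑ b : Fin K with K ≤ (b : Fin K).val + a + 2, x ^ ((b : ℕ) + 1)
      ≤ x ^ K * (K - 1 + x) / (1 - x) := by
  have hT : ∀ a : ℕ, ∑ b : Fin K with K ≤ (b : Fin K).val + a + 2, x ^ ((b : ℕ) + 1)
      ≤ x ^ (K - (a + 2) + 1) / (1 - x) := by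
    intro a
    rw [sum_filter, Fin.sum_univ_eq_sum_range
      (fun b => if K ≤ b + a + 2 then x ^ (b + 1) else 0), ← sum_filter]
    calc _ = ∑ b ∈ Ico (K - (a + 2)) K, x ^ (b + 1) := by
          congr 1
          ext b
          simp only [mem_filter, mem_range, mem_Ico]
          omega
      _ = (∑ b ∈ Ico (K - (a + 2)) K, x ^ b) * x := by
          rw [sum_mul]
          simp [pow_succ]
      _ ≤ x ^ (K - (a + 2)) / (1 - x) * x := by
          gcongr
          exact geom_sum_Ico_le_of_lt_one hx hx1
      _ = _ := by ring
  obtain ⟨n, rfl⟩ : ∃ n, K = n + 1 := ⟨K - 1, by omega⟩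
  rw [Fin.sum_univ_castSucc]
  have h1x : 0 < 1 - x := by linarith
  calc _ ≤ ∑ a : Fin n, x ^ (n + 1) / (1 - x) + x ^ (n + 1) * (x / (1 - x)) := by
        refine add_le_add (sum_le_sum fun a _ => ?_) ?_
        · calc _ ≤ x ^ ((a : ℕ) + 1) * (x ^ (n + 1 - (a + 2) + 1) / (1 - x)) :=
                mul_le_mul_of_nonneg_left (hT a) (by positivity)
            _ = _ := by
                rw [← mul_div_assoc, ← pow_add]
                congr 2
                omega
        · refine mul_le_mul_of_nonneg_left ((hT (Fin.last n)).trans (le_of_eq ?_)) (by positivity)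
          rw [Fin.val_last, show n + 1 - (n + 2) + 1 = 1 by omega, pow_one]
    _ = _ := by
        simp
        field_simp

theorem pairWeight_closed_form_le {K : ℕ} (hK : 6 ≤ K) :
    (31 / 50 : ℝ) ^ K * (K - 1 + 31 / 50) ≤ 9 / 25 := by
  induction K, hK using Nat.le_induction with
  | base => norm_num
  | succ n hn ih =>
    have hn' : (6 : ℝ) ≤ n := by exact_mod_cast hn
    refine le_trans ?_ ih
    rw [pow_succ, mul_assoc]
    gcongr
    push_cast
    linarith

theorem tripleWeight_le {K : ℕ} (hK : 3 ≤ K) {x : ℝ} (hx : 0 ≤ x) (hx' : x ≤ 31 / 50) :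
    tripleWeight K x ≤ (491 / 500) ^ 6 := by
  refine (tripleWeight_mono K hx hx').trans ?_
  rcases Nat.lt_or_ge K 5 with h | h
  · obtain rfl | rfl : K = 3 ∨ K = 4 := by omega
    · exact tripleWeight_three
    · exact tripleWeight_four
  · refine (tripleWeight_le_cube K (by norm_num)).trans ?_
    calc _ ≤ (24 / 25 : ℝ) ^ 3 := by
          gcongr
          rcases h.eq_or_lt with rfl | h
          · exact pairWeight_five
          · refine (pairWeight_le (by omega) (by norm_num) (by norm_num)).trans ?_
            rw [div_le_iff₀ (by norm_num)]
            exact (pairWeight_closed_form_le h).trans (by norm_num)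
      _ ≤ _ := by norm_num

end LetterEstimates

section Segments

open Finset

theorem sum_fin_pow_succ_le (K : ℕ) {x : ℝ} (hx : 0 ≤ x) (hx' : x < 1) :
    ∑ a : Fin K, x ^ ((a : ℕ) + 1) ≤ x / (1 - x) := by
  rw [Fin.sum_univ_eq_sum_range (fun a => x ^ (a + 1)), range_eq_Ico]
  calc _ = (∑ a ∈ Ico 0 K, x ^ a) * x := by
        rw [sum_mul]
        simp [pow_succ]
    _ ≤ x ^ 0 / (1 - x) * x := by
        gcongr
        exact geom_sum_Ico_le_of_lt_one hx hx'
    _ = _ := by ring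

theorem pow_mul_div_pow_le {W θ b : ℝ} (hθ : 0 < θ) (hW : 0 < W) (hWθ : W ≤ 2 * θ) (hb : θ ≤ b)
    {n k r : ℕ} (hk : k ≤ n) (hn : n ≤ k + r) :
    W ^ n * (θ / W) ^ k ≤ b ^ n * 2 ^ r := by
  obtain ⟨s, rfl⟩ := Nat.exists_eq_add_of_le hk
  calc W ^ (k + s) * (θ / W) ^ k = θ ^ k * W ^ s := by
        rw [div_pow, pow_add]
        field_simp
    _ ≤ θ ^ k * (2 * θ) ^ s := by gcongr
    _ = θ ^ (k + s) * 2 ^ s := by ring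
    _ ≤ b ^ (k + s) * 2 ^ r := by
        have := hθ.le.trans hb
        gcongr
        · norm_num
        · omega

open Classical in
/-- The words in `Fin K` of length `n`, weighted by `∏ x ^ (letter + 1)`, such that letters placed
symmetrically with respect to one of three nearby centres have a large sum. -/
noncomputable def segmentWeight (n K d₁ d₂ : ℕ) (x : ℝ) : ℝ :=
  ∑ w : Fin n → Fin K with ∀ t : Fin 3, ∀ i j : Fin n,
    (i : ℕ) + j + ![0, d₁, d₂] t + 1 = n → K ≤ (w i : ℕ) + w j + 2, ∏ i, x ^ ((w i : ℕ) + 1)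

theorem segmentWeight_le {n K D d₁ d₂ : ℕ} (hK : 2 ≤ K) (h₁ : 0 < d₁) (h₁₂ : d₁ < d₂)
    (hD : d₂ ≤ D) {x : ℝ} (hx : 61 / 100 ≤ x) (hx' : x ≤ 31 / 50) :
    segmentWeight n K d₁ d₂ x ≤ (x + x ^ 2) ^ n * 2 ^ (D + 1) := by
  classical
  have hx0 : 0 < x := by linarith
  rcases hK.eq_or_lt with rfl | hK
  · calc _ ≤ ∑ w : Fin n → Fin 2, ∏ i, x ^ ((w i : ℕ) + 1) :=
          sum_le_sum_of_subset_of_nonneg (filter_subset _ _) fun _ _ _ => by positivity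
      _ = (x + x ^ 2) ^ n := by
          rw [← Fintype.sum_pow (fun a : Fin 2 => x ^ ((a : ℕ) + 1))]
          simp [Fin.sum_univ_succ]
      _ ≤ _ := le_mul_of_one_le_right (by positivity) (one_le_pow₀ (by norm_num))
  · set d : Fin 3 → ℕ := ![0, d₁, d₂] with hd
    have hdD : ∀ t, d t ≤ D := by
      intro t
      fin_cases t <;> simp [hd] <;> omega
    have hdinj : Function.Injective d := by
      intro s t
      fin_cases s <;> fin_cases t <;> simp [hd] <;> omega
    set L : Finset (Fin n) := {v | 2 * (v : Fin n).val + D + 1 < n} with hL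
    let e : Fin 3 → Fin n → Fin n := fun t v => ⟨n - 1 - d t - v, by have := v.2; omega⟩
    set W : ℝ := ∑ a : Fin K, x ^ ((a : ℕ) + 1) with hWdef
    have hW1 : x + x ^ 2 ≤ W := by
      obtain ⟨k, rfl⟩ : ∃ k, K = k + 2 := ⟨K - 2, by omega⟩
      rw [hWdef, Fin.sum_univ_succ, Fin.sum_univ_succ, ← add_assoc]
      simp only [Fin.val_zero, Fin.val_succ, zero_add, pow_one, Nat.reduceAdd]
      exact le_add_of_nonneg_right (by positivity)
    have hW2 : W ≤ 2 * (491 / 500) := by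
      refine (sum_fin_pow_succ_le K hx0.le (by linarith)).trans ?_
      rw [div_le_iff₀ (by linarith)]
      linarith
    have hθ : (491 / 500 : ℝ) ≤ x + x ^ 2 := by nlinarith
    have hW0 : 0 < W := by linarith
    have key := sum_prod_bipartite_le (fun a : Fin K => x ^ ((a : ℕ) + 1))
      (fun a => by positivity) hW0 L e
      (by
        intro t u hu v hv h
        simp only [hL, coe_filter, mem_univ, true_and, Set.mem_ofPred_eq] at hu hv
        simp only [e, Fin.mk.injEq] at h
        have := hdD t
        ext
        omega)
      (by
        intro t v hv
        simp only [hL, mem_filter, mem_univ, true_and, e] at hv ⊢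
        have := hdD t
        omega)
      (by
        intro v hv s t h
        simp only [hL, mem_filter, mem_univ, true_and, e, Fin.mk.injEq] at hv h
        have := hdD t
        have := hdD s
        apply hdinj
        omega)
      (fun a b => K ≤ (a : ℕ) + b + 2) (θ := 491 / 500)
      (by
        have h := tripleWeight_le hK hx0.le hx'
        unfold tripleWeight at h
        convert h)
    have hcard : #L = (n - D) / 2 := by
      have : L = ({v | v.val < (n - D) / 2} : Finset (Fin n)) := by
        ext v
        simp only [hL, mem_filter, mem_univ, true_and]
        omega
      rw [this, Fin.card_filter_val_lt]
      omega
    calc _ ≤ _ := sum_le_sum_of_subset_of_nonneg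
          (fun w hw => by
            simp only [mem_filter, mem_univ, true_and] at hw ⊢
            intro v hv t
            simp only [hL, mem_filter, mem_univ, true_and] at hv
            apply hw t
            have := hdD t
            change (v : ℕ) + (n - 1 - d t - v) + d t + 1 = n
            omega) fun _ _ _ => by positivity
      _ ≤ _ := key
      _ ≤ _ := by
          rw [Fintype.card_fin]
          exact pow_mul_div_pow_le (by norm_num) hW0 hW2 hθ (by omega) (by omega)

end Segments

section Gapsets

open Finset

/-- `G` is the set of gaps of a numerical semigroup of multiplicity `m`. -/
structure IsGapset (m : ℕ) (G : Finset ℕ) : Prop where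
  pos : 0 < m
  zero_notMem : 0 ∉ G
  add_notMem : ∀ ⦃a b : ℕ⦄, a ∉ G → b ∉ G → a + b ∉ G
  notMem : m ∉ G
  mem_of_lt : ∀ ⦃i : ℕ⦄, 0 < i → i < m → i ∈ G

theorem Finset.sum_comp_le_sum_of_injOn {α β : Type*} [DecidableEq β] {s : Finset α}
    {t : Finset β} (φ : α → β) (hst : ∀ a ∈ s, φ a ∈ t) (hφ : Set.InjOn φ s) {f : β → ℝ}
    (hf : ∀ b ∈ t, 0 ≤ f b) : ∑ a ∈ s, f (φ a) ≤ ∑ b ∈ t, f b := by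
  rw [← sum_image (fun a ha b hb h => hφ ha hb h)]
  exact sum_le_sum_of_subset_of_nonneg (image_subset_iff.2 hst) fun b hb _ => hf b hb

namespace IsGapset

variable {m : ℕ} {G : Finset ℕ}

theorem lt_two_mul_card (hG : IsGapset m G) {a : ℕ} (ha : a ∈ G) : a < 2 * #G := by
  have hcover : range (a + 1) ⊆ G ∪ G.image (a - ·) := by
    intro i hi
    rw [mem_range] at hi
    by_contra h
    simp only [mem_union, mem_image, not_or, not_exists, not_and] at h
    have h1 : a - i ∉ G := fun h' => h.2 _ h' (by omega)
    have h2 := hG.add_notMem h.1 h1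
    rw [Nat.add_sub_cancel' (by omega)] at h2
    exact h2 ha
  have h1 := card_le_card hcover
  have h2 := card_union_le G (G.image (a - ·))
  have h3 := card_image_le (s := G) (f := (a - ·))
  rw [card_range] at h1
  omega

theorem le_card_add_one (hG : IsGapset m G) : m ≤ #G + 1 := by
  have : Ioo 0 m ⊆ G := fun i hi => hG.mem_of_lt (mem_Ioo.1 hi).1 (mem_Ioo.1 hi).2
  have := card_le_card this
  rw [Nat.card_Ioo] at this
  omega

theorem filter_lt (hG : IsGapset m G) {c : ℕ} (hc : m ≤ c) : IsGapset m (G.filter (· < c)) where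
  pos := hG.pos
  zero_notMem h := hG.zero_notMem (mem_filter.1 h).1
  add_notMem a b ha hb h := by
    simp only [mem_filter, not_and] at ha hb h
    refine hG.add_notMem (fun h' => ?_) (fun h' => ?_) h.1
    · have := ha h'
      omega
    · have := hb h'
      omega
  notMem h := hG.notMem (mem_filter.1 h).1
  mem_of_lt i hi him := mem_filter.2 ⟨hG.mem_of_lt hi him, by omega⟩

/-- A bound for the sum over the gap sets of small depth, i.e. those with all gaps below `2 * m`. -/
theorem sum_pow_card_le_of_subset_range {𝒢 : Finset (Finset ℕ)} (h𝒢 : ∀ G ∈ 𝒢, IsGapset m G)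
    (hm : ∀ G ∈ 𝒢, G ⊆ range (2 * m)) {x : ℝ} (hx : 0 ≤ x) :
    ∑ G ∈ 𝒢, x ^ #G ≤ (x + x ^ 2) ^ (m - 1) := by
  have hsplit : ∀ G ∈ 𝒢, G = Ioo 0 m ∪ G.filter (m < ·) := by
    intro G hG
    ext i
    have h0 := (h𝒢 G hG).zero_notMem
    have h1 := (h𝒢 G hG).notMem
    have h2 := (h𝒢 G hG).mem_of_lt (i := i)
    simp only [mem_union, mem_Ioo, mem_filter]
    constructor
    · intro hi
      have h3 : i ≠ 0 := fun h => h0 (h ▸ hi)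
      have h4 : i ≠ m := fun h => h1 (h ▸ hi)
      by_cases him : i < m
      · exact Or.inl ⟨by omega, him⟩
      · exact Or.inr ⟨hi, by omega⟩
    · rintro (hi | hi)
      · exact h2 hi.1 hi.2
      · exact hi.1
  have hcard : ∀ G ∈ 𝒢, #G = (m - 1) + #(G.filter (m < ·)) := by
    intro G hG
    nth_rw 1 [hsplit G hG]
    rw [card_union_of_disjoint, Nat.card_Ioo, Nat.sub_zero]
    rw [disjoint_left]
    intro i hi hi'
    have := (mem_Ioo.1 hi).2
    have := (mem_filter.1 hi').2
    omega
  calc ∑ G ∈ 𝒢, x ^ #G = ∑ G ∈ 𝒢, x ^ ((m - 1) + #(G.filter (m < ·))) :=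
        sum_congr rfl fun G hG => by rw [← hcard G hG]
    _ ≤ ∑ B ∈ (Ioo m (2 * m)).powerset, x ^ ((m - 1) + #B) := by
        refine sum_comp_le_sum_of_injOn (f := fun B => x ^ ((m - 1) + #B)) _ ?_ ?_
          fun _ _ => by positivity
        · intro G hG
          rw [mem_powerset]
          intro i hi
          rw [mem_filter] at hi
          exact mem_Ioo.2 ⟨hi.2, mem_range.1 (hm G hG hi.1)⟩
        · intro G hG H hH h
          rw [hsplit G hG, hsplit H hH]
          exact congrArg _ h
    _ = (x + x ^ 2) ^ (m - 1) := by
        simp_rw [pow_add]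
        rw [← mul_sum]
        have := sum_pow_mul_eq_add_pow x 1 (Ioo m (2 * m))
        simp only [one_pow, mul_one, Nat.card_Ioo] at this
        rw [this, show 2 * m - m - 1 = m - 1 by omega, ← mul_pow]
        ring

end IsGapset

/-- The largest element of `G` is at least `2 * m`, and `G` has two further elements within
distance `D` of it. -/
def IsCrowdedAtTop (m D : ℕ) (G : Finset ℕ) : Prop :=
  ∃ f d₁ d₂, 2 * m ≤ f ∧ 0 < d₁ ∧ d₁ < d₂ ∧ d₂ ≤ D ∧ f ∈ G ∧ f - d₁ ∈ G ∧ f - d₂ ∈ G ∧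
    ∀ a ∈ G, a ≤ f

theorem exists_card_filter_le_and_isCrowdedAtTop {m D : ℕ} (hD : D ≤ m) (j : ℕ) (G : Finset ℕ)
    (hG : G ⊆ range (2 * m + (D + 1) * j)) :
    ∃ c ≥ m, #(G.filter (c ≤ ·)) ≤ 2 * j ∧
      (G.filter (· < c) ⊆ range (2 * m) ∨ IsCrowdedAtTop m D (G.filter (· < c))) := by
  induction j generalizing G with
  | zero =>
    refine ⟨2 * m, by omega, ?_, Or.inl fun i hi => mem_range.2 (mem_filter.1 hi).2⟩
    rw [Nat.le_zero, card_eq_zero, filter_eq_empty_iff]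
    intro i hi
    have := mem_range.1 (hG hi)
    omega
  | succ j ih =>
    by_cases hgood : G ⊆ range (2 * m) ∨ IsCrowdedAtTop m D G
    · refine ⟨2 * m + (D + 1) * (j + 1), by lia, ?_, ?_⟩
      · rw [card_eq_zero.2 (filter_eq_empty_iff.2 fun i hi => ?_)]
        · exact Nat.zero_le _
        · exact not_le.2 (mem_range.1 (hG hi))
      · rwa [filter_true_of_mem fun i hi => mem_range.1 (hG hi)]
    · rw [not_or] at hgood
      obtain ⟨b, hb, hbm⟩ := not_subset.1 hgood.1
      rw [mem_range, not_lt] at hbm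
      set f := G.max' ⟨b, hb⟩ with hf
      have hfG : f ∈ G := max'_mem _ _
      have hfmax : ∀ a ∈ G, a ≤ f := fun a ha => le_max' _ _ ha
      have hfm : 2 * m ≤ f := hbm.trans (hfmax b hb)
      have hfr := mem_range.1 (hG hfG)
      rw [mul_add, mul_one] at hfr
      obtain ⟨c, hc, hcard, hgood'⟩ := ih (G.filter (· < f - D)) fun i hi => by
        rw [mem_filter] at hi
        rw [mem_range]
        omega
      have htop : #(G.filter (f - D ≤ ·)) ≤ 2 := by
        by_contra! h
        have hfT : f ∈ G.filter (f - D ≤ ·) := mem_filter.2 ⟨hfG, by omega⟩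
        have h1 : 1 < #((G.filter (f - D ≤ ·)).erase f) := by
          rw [card_erase_of_mem hfT]
          omega
        obtain ⟨p, q, hp, hq, hpq⟩ := one_lt_card_iff.1 h1
        wlog hlt : p < q generalizing p q
        · exact this q p hq hp hpq.symm (by omega)
        simp only [mem_erase, mem_filter] at hp hq
        have := hfmax q hq.2.1
        refine hgood.2 ⟨f, f - q, f - p, hfm, by omega, by omega, by omega, hfG, ?_, ?_, hfmax⟩
        · rw [Nat.sub_sub_self (by omega)]
          exact hq.2.1
        · rw [Nat.sub_sub_self (by omega)]
          exact hp.2.1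
      refine ⟨min c (f - D), le_min hc (by omega), ?_, ?_⟩
      · have : G.filter (min c (f - D) ≤ ·) ⊆
            (G.filter (· < f - D)).filter (c ≤ ·) ∪ G.filter (f - D ≤ ·) := by
          intro i hi
          simp only [mem_union, mem_filter] at hi ⊢
          have := hi.2
          by_cases h : i < f - D
          · exact Or.inl ⟨⟨hi.1, h⟩, by omega⟩
          · exact Or.inr ⟨hi.1, by omega⟩
        have := (card_le_card this).trans (card_union_le _ _)
        omega
      · rwa [filter_filter, show G.filter (fun i => i < f - D ∧ i < c) =
          G.filter (· < min c (f - D)) from filter_congr fun i _ => by omega] at hgood'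

end Gapsets

section Kunz

open Finset

/-- The Kunz coordinate of the residue class of `i` modulo `m`. -/
noncomputable def kunz (m : ℕ) (G : Finset ℕ) (i : ℕ) : ℕ := sInf {q | q * m + i ∉ G}

/-- The Kunz coordinates of the `n` residue classes following `c`, as a word in `Fin K`. -/
noncomputable def kunzWord (m c n K : ℕ) (hK : 0 < K) (G : Finset ℕ) : Fin n → Fin K :=
  fun i => ⟨(kunz m G (c + 1 + i) - 1) % K, Nat.mod_lt _ hK⟩

namespace IsGapset

variable {m : ℕ} {G : Finset ℕ}

theorem mul_notMem (hG : IsGapset m G) (n : ℕ) : n * m ∉ G := by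
  induction n with
  | zero => simpa using hG.zero_notMem
  | succ n ih =>
    rw [Nat.succ_mul]
    exact hG.add_notMem ih hG.notMem

theorem kunz_mul_add_notMem (hG : IsGapset m G) (i : ℕ) : kunz m G i * m + i ∉ G := by
  have hne : {q | q * m + i ∉ G}.Nonempty := by
    refine ⟨2 * #G, fun h => ?_⟩
    have h1 := hG.lt_two_mul_card h
    have h2 := Nat.le_mul_of_pos_right (2 * #G) hG.pos
    omega
  exact Nat.sInf_mem hne

theorem mul_add_mem_iff (hG : IsGapset m G) {q i : ℕ} : q * m + i ∈ G ↔ q < kunz m G i := by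
  constructor
  · intro h
    by_contra! hq
    obtain ⟨r, rfl⟩ := Nat.exists_eq_add_of_le hq
    refine hG.add_notMem (hG.kunz_mul_add_notMem i) (hG.mul_notMem r) ?_
    convert h using 1
    ring
  · intro h
    by_contra hq
    exact absurd (Nat.sInf_le (s := {q | q * m + i ∉ G}) hq) (not_le.2 h)

theorem mem_iff (hG : IsGapset m G) {a : ℕ} : a ∈ G ↔ a / m < kunz m G (a % m) := by
  rw [← hG.mul_add_mem_iff, Nat.div_add_mod']

theorem ext_kunz {H : Finset ℕ} (hG : IsGapset m G) (hH : IsGapset m H)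
    (h : ∀ i < m, kunz m G i = kunz m H i) : G = H := by
  ext a
  rw [hG.mem_iff, hH.mem_iff, h _ (Nat.mod_lt _ hG.pos)]

theorem kunz_zero (hG : IsGapset m G) : kunz m G 0 = 0 := by
  have := hG.mul_add_mem_iff (q := 0) (i := 0)
  simpa [hG.zero_notMem] using this.not

theorem kunz_pos (hG : IsGapset m G) {i : ℕ} (hi : 0 < i) (him : i < m) : 0 < kunz m G i := by
  rw [← hG.mul_add_mem_iff, zero_mul, zero_add]
  exact hG.mem_of_lt hi him

theorem kunz_add_le (hG : IsGapset m G) (i j : ℕ) :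
    kunz m G (i + j) ≤ kunz m G i + kunz m G j := by
  rw [← not_lt, ← hG.mul_add_mem_iff]
  convert hG.add_notMem (hG.kunz_mul_add_notMem i) (hG.kunz_mul_add_notMem j) using 2
  ring

theorem card_eq_sum_kunz (hG : IsGapset m G) : #G = ∑ i ∈ range m, kunz m G i := by
  rw [card_eq_sum_card_fiberwise (f := (· % m)) (t := range m)
    fun a _ => mem_range.2 (Nat.mod_lt _ hG.pos)]
  refine sum_congr rfl fun i hi => ?_
  have him := mem_range.1 hi
  have : G.filter (· % m = i) = (range (kunz m G i)).image (· * m + i) := by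
    ext a
    simp only [mem_filter, mem_image, mem_range]
    constructor
    · rintro ⟨ha, rfl⟩
      exact ⟨a / m, hG.mem_iff.1 ha, Nat.div_add_mod' a m⟩
    · rintro ⟨q, hq, rfl⟩
      refine ⟨hG.mul_add_mem_iff.2 hq, ?_⟩
      rw [add_comm, Nat.add_mul_mod_self_right, Nat.mod_eq_of_lt him]
  rw [this, card_image_of_injective, card_range]
  intro p q h
  exact Nat.eq_of_mul_eq_mul_right hG.pos (Nat.add_right_cancel h)

theorem card_eq_add_kunz_add (hG : IsGapset m G) {s : ℕ} (hs : 0 < s) (hsm : s < m) :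
    #G = ∑ i : Fin (s - 1), kunz m G (i + 1) + kunz m G s +
      ∑ i : Fin (m - 1 - s), kunz m G (s + 1 + i) := by
  rw [hG.card_eq_sum_kunz, Fin.sum_univ_eq_sum_range (fun i => kunz m G (i + 1)),
    Fin.sum_univ_eq_sum_range (fun i => kunz m G (s + 1 + i))]
  obtain ⟨s, rfl⟩ : ∃ t, s = t + 1 := ⟨s - 1, by omega⟩
  obtain ⟨n, rfl⟩ : ∃ n, m = s + 1 + 1 + n := ⟨m - (s + 2), by omega⟩
  rw [sum_range_add, sum_range_succ, sum_range_succ', hG.kunz_zero,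
    show s + 1 + 1 + n - 1 - (s + 1) = n by omega]
  rfl

theorem kunzWord_add_one (hG : IsGapset m G) {c n K : ℕ} (hK : 0 < K) (hc : c + n < m)
    (i : Fin n) (hi : kunz m G (c + 1 + i) ≤ K) :
    (kunzWord m c n K hK G i : ℕ) + 1 = kunz m G (c + 1 + i) := by
  have := hG.kunz_pos (i := c + 1 + i) (by omega) (by omega)
  change (kunz m G (c + 1 + i) - 1) % K + 1 = _
  rw [Nat.mod_eq_of_lt (by omega)]
  omega

end IsGapset

/-- A bound for the gap sets with largest element `(K - 1) * m + s` and two further prescribed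
elements near the top. -/
theorem sum_pow_card_le_of_isGreatest {m K s D d₁ d₂ : ℕ} (hK : 3 ≤ K) (hs : 0 < s) (hsm : s < m)
    (hDm : D ≤ m) (h₁ : 0 < d₁) (h₁₂ : d₁ < d₂) (hD : d₂ ≤ D) {𝒢 : Finset (Finset ℕ)}
    (h𝒢 : ∀ G ∈ 𝒢, IsGapset m G)
    (hd : ∀ G ∈ 𝒢, ∀ t : Fin 3, (K - 1) * m + s - ![0, d₁, d₂] t ∈ G)
    (hmax : ∀ G ∈ 𝒢, ∀ a ∈ G, a ≤ (K - 1) * m + s)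
    {x : ℝ} (hx : 61 / 100 ≤ x) (hx' : x ≤ 31 / 50) :
    ∑ G ∈ 𝒢, x ^ #G ≤ (x + x ^ 2) ^ (m - 2) * 4 ^ (D + 1) := by
  classical
  have hx0 : 0 < x := by linarith
  have hdD : ∀ t, ![0, d₁, d₂] t ≤ D := by
    intro t
    fin_cases t <;> simp <;> omega
  obtain ⟨K, rfl⟩ : ∃ k, K = k + 1 := ⟨K - 1, by omega⟩
  rw [Nat.add_sub_cancel] at hd hmax
  have hle : ∀ G ∈ 𝒢, ∀ i < m, kunz m G i ≤ K + 1 := by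
    intro G hG i hi
    rw [← not_lt, ← (h𝒢 G hG).mul_add_mem_iff]
    intro h
    have := hmax G hG _ h
    lia
  have hle' : ∀ G ∈ 𝒢, ∀ i, s < i → kunz m G i ≤ K := by
    intro G hG i hi
    rw [← not_lt, ← (h𝒢 G hG).mul_add_mem_iff]
    intro h
    have := hmax G hG _ h
    omega
  have hks : ∀ G ∈ 𝒢, kunz m G s = K + 1 := by
    intro G hG
    refine le_antisymm (hle G hG s hsm) ?_
    rw [Nat.add_one_le_iff, ← (h𝒢 G hG).mul_add_mem_iff]
    simpa using hd G hG 0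
  let lo : Finset ℕ → Fin (s - 1) → Fin (K + 1) := kunzWord m 0 (s - 1) (K + 1) (by omega)
  let hi : Finset ℕ → Fin (m - 1 - s) → Fin K := kunzWord m s (m - 1 - s) K (by omega)
  have hlo : ∀ G ∈ 𝒢, ∀ i, (lo G i : ℕ) + 1 = kunz m G (0 + 1 + i) := fun G hG i =>
    (h𝒢 G hG).kunzWord_add_one _ (by omega) i (hle G hG _ (by omega))
  have hhi : ∀ G ∈ 𝒢, ∀ i, (hi G i : ℕ) + 1 = kunz m G (s + 1 + i) := fun G hG i =>
    (h𝒢 G hG).kunzWord_add_one _ (by omega) i (hle' G hG _ (by omega))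
  have hterm : ∀ G ∈ 𝒢, x ^ #G ≤
      (∏ i, x ^ ((lo G i : ℕ) + 1)) * ∏ i, x ^ ((hi G i : ℕ) + 1) := by
    intro G hG
    rw [(h𝒢 G hG).card_eq_add_kunz_add hs hsm, pow_add, pow_add]
    simp_rw [hlo G hG, hhi G hG, prod_pow_eq_pow_sum, zero_add, add_comm 1]
    gcongr
    exact mul_le_of_le_one_right (by positivity) (pow_le_one₀ hx0.le (by linarith))
  have hinj : Set.InjOn (fun G => (lo G, hi G)) 𝒢 := by
    intro G hG H hH h
    rw [Prod.mk.injEq] at h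
    refine (h𝒢 G hG).ext_kunz (h𝒢 H hH) fun i him => ?_
    rcases Nat.eq_zero_or_pos i with rfl | hi0
    · rw [(h𝒢 G hG).kunz_zero, (h𝒢 H hH).kunz_zero]
    rcases lt_trichotomy i s with his | rfl | his
    · have h1 := hlo G hG ⟨i - 1, by omega⟩
      have h2 := hlo H hH ⟨i - 1, by omega⟩
      rw [h.1, h2] at h1
      rw [show i = 0 + 1 + (i - 1) by omega]
      exact h1.symm
    · rw [hks G hG, hks H hH]
    · have h1 := hhi G hG ⟨i - (s + 1), by omega⟩
      have h2 := hhi H hH ⟨i - (s + 1), by omega⟩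
      rw [h.2, h2] at h1
      rw [show i = s + 1 + (i - (s + 1)) by omega]
      exact h1.symm
  calc ∑ G ∈ 𝒢, x ^ #G
      ≤ ∑ G ∈ 𝒢, (∏ i, x ^ ((lo G i : ℕ) + 1)) * ∏ i, x ^ ((hi G i : ℕ) + 1) :=
        sum_le_sum hterm
    _ ≤ segmentWeight (s - 1) (K + 1) d₁ d₂ x * segmentWeight (m - 1 - s) K d₁ d₂ x := by
        unfold segmentWeight
        rw [sum_mul_sum, ← sum_product']
        refine sum_comp_le_sum_of_injOn (fun G => (lo G, hi G)) ?_ hinj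
          (f := fun w => (∏ i, x ^ ((w.1 i : ℕ) + 1)) * ∏ i, x ^ ((w.2 i : ℕ) + 1))
          fun _ _ => by positivity
        intro G hG
        simp only [mem_product, mem_filter, mem_univ, true_and]
        constructor
        · intro t i j hij
          have h1 := (h𝒢 G hG).kunz_add_le (0 + 1 + i) (0 + 1 + j)
          rw [← hlo G hG, ← hlo G hG] at h1
          have h2 := hd G hG t
          rw [show K * m + s - ![0, d₁, d₂] t = K * m + (0 + 1 + i + (0 + 1 + j)) by omega,
            (h𝒢 G hG).mul_add_mem_iff] at h2
          omega
        · intro t i j hij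
          have h1 := (h𝒢 G hG).kunz_add_le (s + 1 + i) (s + 1 + j)
          rw [← hhi G hG, ← hhi G hG] at h1
          have h2 := hd G hG t
          obtain ⟨k, hk⟩ : ∃ k, K = k + 1 := ⟨K - 1, by omega⟩
          have h3 : K * m = k * m + m := by rw [hk, Nat.succ_mul]
          rw [show K * m + s - ![0, d₁, d₂] t = k * m + (s + 1 + i + (s + 1 + j)) by omega,
            (h𝒢 G hG).mul_add_mem_iff] at h2
          omega
    _ ≤ ((x + x ^ 2) ^ (s - 1) * 2 ^ (D + 1)) * ((x + x ^ 2) ^ (m - 1 - s) * 2 ^ (D + 1)) := by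
        gcongr
        · unfold segmentWeight
          positivity
        · exact segmentWeight_le (by omega) h₁ h₁₂ hD hx hx'
        · exact segmentWeight_le (by omega) h₁ h₁₂ hD hx hx'
    _ = (x + x ^ 2) ^ (m - 2) * 4 ^ (D + 1) := by
        rw [show m - 2 = (s - 1) + (m - 1 - s) by omega, pow_add,
          show (4 : ℝ) = 2 * 2 by norm_num, mul_pow]
        ring

end Kunz

section Counting

open Finset

theorem pow_sub_le_two_pow_mul {y : ℝ} (hy : 1 / 2 ≤ y) {k m : ℕ} (hk : k ≤ m) :
    y ^ (m - k) ≤ 2 ^ k * y ^ m := by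
  obtain ⟨r, rfl⟩ := Nat.exists_eq_add_of_le hk
  have hy0 : 0 < y := by linarith
  rw [Nat.add_sub_cancel_left, pow_add, ← mul_assoc, ← mul_pow]
  exact le_mul_of_one_le_left (by positivity) (one_le_pow₀ (by linarith))

theorem card_filter_card_le_le (N t : ℕ) :
    #{T ∈ (range N).powerset | #T ≤ t} ≤ (t + 1) * (N + 1) ^ t := by
  have hsub : {T ∈ (range N).powerset | #T ≤ t} ⊆
      (range (t + 1)).biUnion fun i => (range N).powersetCard i := by
    intro T hT
    simp only [mem_filter, mem_powerset, mem_biUnion, mem_range, mem_powersetCard] at hT ⊢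
    exact ⟨#T, by omega, hT.1, rfl⟩
  calc _ ≤ _ := card_le_card hsub
    _ ≤ ∑ i ∈ range (t + 1), #((range N).powersetCard i) := card_biUnion_le
    _ ≤ ∑ i ∈ range (t + 1), (N + 1) ^ t := by
        refine sum_le_sum fun i hi => ?_
        rw [card_powersetCard, card_range]
        calc N.choose i ≤ N ^ i := Nat.choose_le_pow N i
          _ ≤ (N + 1) ^ i := by gcongr; omega
          _ ≤ (N + 1) ^ t := Nat.pow_le_pow_right (by omega) (by have := mem_range.1 hi; omega)
    _ = _ := by simp

open Classical in
theorem sum_pow_card_le_of_good {m D g : ℕ} (hm : 0 < m) (hDm : D ≤ m)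
    {𝒢 : Finset (Finset ℕ)} (h𝒢 : ∀ G ∈ 𝒢, IsGapset m G) (hg : ∀ G ∈ 𝒢, #G ≤ g)
    (hgood : ∀ G ∈ 𝒢, G ⊆ range (2 * m) ∨ IsCrowdedAtTop m D G)
    {x : ℝ} (hx : 61 / 100 ≤ x) (hx' : x ≤ 31 / 50) :
    ∑ G ∈ 𝒢, x ^ #G ≤ (x + x ^ 2) ^ m * (2 + 8 * g * (D + 1) ^ 2 * 4 ^ (D + 1)) := by
  have hx0 : 0 < x := by linarith
  have hy : 1 / 2 ≤ x + x ^ 2 := by nlinarith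
  let P : ℕ × ℕ × ℕ → Finset ℕ → Prop := fun p G => 2 * m ≤ p.1 ∧ 0 < p.2.1 ∧ p.2.1 < p.2.2 ∧
    p.2.2 ≤ D ∧ p.1 ∈ G ∧ p.1 - p.2.1 ∈ G ∧ p.1 - p.2.2 ∈ G ∧ ∀ a ∈ G, a ≤ p.1
  let I : Finset (ℕ × ℕ × ℕ) := range (2 * g) ×ˢ range (D + 1) ×ˢ range (D + 1)
  have hA : ∑ G ∈ 𝒢 with G ⊆ range (2 * m), x ^ #G ≤ 2 * (x + x ^ 2) ^ m := by
    refine (IsGapset.sum_pow_card_le_of_subset_range (m := m)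
      (fun G hG => h𝒢 G (mem_filter.1 hG).1) (fun G hG => (mem_filter.1 hG).2) hx0.le).trans ?_
    simpa using pow_sub_le_two_pow_mul hy (k := 1) hm
  have hB : ∀ p ∈ I, ∑ G ∈ 𝒢 with P p G, x ^ #G ≤ 4 * 4 ^ (D + 1) * (x + x ^ 2) ^ m := by
    rintro ⟨f, d₁, d₂⟩ -
    rcases ({G ∈ 𝒢 | P (f, d₁, d₂) G}).eq_empty_or_nonempty with h | ⟨H, hH⟩
    · rw [h, sum_empty]
      positivity
    · rw [mem_filter] at hH
      obtain ⟨hf, h₁, h₁₂, hD, hfH, -⟩ := hH.2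
      have hs : 0 < f % m := by
        refine Nat.pos_of_ne_zero fun h => ?_
        have := (h𝒢 H hH.1).mul_notMem (f / m)
        rw [Nat.div_mul_cancel (Nat.dvd_of_mod_eq_zero h)] at this
        exact this hfH
      have hsm : f % m < m := Nat.mod_lt _ hm
      have hK : 2 ≤ f / m := (Nat.le_div_iff_mul_le hm).2 hf
      have hfe : (f / m + 1 - 1) * m + f % m = f := by
        rw [Nat.add_sub_cancel, Nat.div_add_mod']
      refine (sum_pow_card_le_of_isGreatest (m := m) (K := f / m + 1) (s := f % m) (D := D)
        (d₁ := d₁) (d₂ := d₂) (by omega) hs hsm hDm h₁ h₁₂ hD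
        (fun G hG => h𝒢 G (mem_filter.1 hG).1) ?_ ?_ hx hx').trans ?_
      · intro G hG t
        obtain ⟨-, -, -, -, h0, h1, h2, -⟩ := (mem_filter.1 hG).2
        rw [hfe]
        fin_cases t
        · exact h0
        · exact h1
        · exact h2
      · intro G hG
        rw [hfe]
        obtain ⟨-, -, -, -, -, -, -, h⟩ := (mem_filter.1 hG).2
        exact h
      · have := pow_sub_le_two_pow_mul hy (k := 2) (m := m) (by omega)
        calc _ ≤ 2 ^ 2 * (x + x ^ 2) ^ m * 4 ^ (D + 1) := by gcongr
          _ = _ := by ring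
  have hterm : ∀ G ∈ 𝒢, x ^ #G ≤ (if G ⊆ range (2 * m) then x ^ #G else 0) +
      ∑ p ∈ I, if P p G then x ^ #G else 0 := by
    intro G hG
    rcases hgood G hG with h | ⟨f, d₁, d₂, h⟩
    · rw [if_pos h]
      exact le_add_of_nonneg_right (sum_nonneg fun p _ => by positivity)
    · have hp : (f, d₁, d₂) ∈ I := by
        have h1 := (h𝒢 G hG).lt_two_mul_card h.2.2.2.2.1
        have h2 := hg G hG
        simp only [I, mem_product, mem_range]
        omega
      calc x ^ #G = if P (f, d₁, d₂) G then x ^ #G else 0 := (if_pos h).symm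
        _ ≤ ∑ p ∈ I, if P p G then x ^ #G else 0 :=
          single_le_sum (f := fun p => if P p G then x ^ #G else 0)
            (fun p _ => by positivity) hp
        _ ≤ _ := le_add_of_nonneg_left (by positivity)
  calc _ ≤ _ := sum_le_sum hterm
    _ = ∑ G ∈ 𝒢 with G ⊆ range (2 * m), x ^ #G + ∑ p ∈ I, ∑ G ∈ 𝒢 with P p G, x ^ #G := by
        rw [sum_add_distrib, sum_comm]
        simp_rw [sum_filter]
    _ ≤ 2 * (x + x ^ 2) ^ m + ∑ p ∈ I, 4 * 4 ^ (D + 1) * (x + x ^ 2) ^ m :=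
        add_le_add hA (sum_le_sum hB)
    _ = _ := by
        simp only [I, sum_const, card_product, card_range, nsmul_eq_mul]
        push_cast
        ring

open Classical in
/-- The gap sets of the numerical semigroups of multiplicity `m` and genus `g`. -/
noncomputable def gapsets (m g : ℕ) : Finset (Finset ℕ) :=
  {G ∈ (range (2 * g)).powerset | IsGapset m G ∧ #G = g}

theorem mem_gapsets {m g : ℕ} {G : Finset ℕ} : G ∈ gapsets m g ↔ IsGapset m G ∧ #G = g := by
  simp only [gapsets, mem_filter, mem_powerset, and_iff_right_iff_imp]
  rintro ⟨hG, rfl⟩ a ha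
  exact mem_range.2 (hG.lt_two_mul_card ha)

theorem card_gapsets_mul_pow_le {m g D J : ℕ} (hm : 0 < m) (hDm : D ≤ m)
    (hJ : 2 * g ≤ 2 * m + (D + 1) * J) {x : ℝ} (hx : 61 / 100 ≤ x) (hx' : x ≤ 31 / 50) :
    #(gapsets m g) * x ^ g ≤ (2 * J + 1) * (2 * g + 1) ^ (2 * J) *
      ((x + x ^ 2) ^ m * (2 + 8 * g * (D + 1) ^ 2 * 4 ^ (D + 1))) := by
  classical
  have hx0 : 0 < x := by linarith
  have hex : ∀ G : Finset ℕ, ∃ c, G ∈ gapsets m g → c ≥ m ∧ #(G.filter (c ≤ ·)) ≤ 2 * J ∧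
      (G.filter (· < c) ⊆ range (2 * m) ∨ IsCrowdedAtTop m D (G.filter (· < c))) := by
    intro G
    by_cases hG : G ∈ gapsets m g
    · obtain ⟨c, hc⟩ := exists_card_filter_le_and_isCrowdedAtTop hDm J G fun a ha => by
        rw [mem_gapsets] at hG
        have := hG.1.lt_two_mul_card ha
        rw [mem_range]
        omega
      exact ⟨c, fun _ => hc⟩
    · exact ⟨0, fun h => absurd h hG⟩
  choose c hc using hex
  set 𝒢 : Finset (Finset ℕ) := {H ∈ (range (2 * g)).powerset | IsGapset m H ∧ #H ≤ g ∧
    (H ⊆ range (2 * m) ∨ IsCrowdedAtTop m D H)} with h𝒢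
  have hcard : #(gapsets m g) ≤ #{T ∈ (range (2 * g)).powerset | #T ≤ 2 * J} * #𝒢 := by
    rw [← card_product]
    refine card_le_card_of_injOn
      (fun G => (G.filter (c G ≤ ·), G.filter (· < c G))) ?_ ?_
    · intro G hG
      have hG' := mem_gapsets.1 hG
      have hc' := hc G hG
      have hsub : ∀ a ∈ G, a < 2 * g := fun a ha => hG'.2 ▸ hG'.1.lt_two_mul_card ha
      simp only [coe_product, Set.mem_prod, mem_coe, h𝒢, mem_filter, mem_powerset]
      refine ⟨⟨fun a ha => mem_range.2 (hsub a (mem_filter.1 ha).1), hc'.2.1⟩,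
        fun a ha => mem_range.2 (hsub a (mem_filter.1 ha).1), hG'.1.filter_lt hc'.1,
        hG'.2 ▸ card_filter_le _ _, hc'.2.2⟩
    · intro G _ H _ h
      rw [Prod.mk.injEq] at h
      have hsplit : ∀ F : Finset ℕ, F = F.filter (c F ≤ ·) ∪ F.filter (· < c F) := by
        intro F
        ext a
        simp only [mem_union, mem_filter, ← and_or_left]
        exact (and_iff_left (le_or_gt _ _)).symm
      rw [hsplit G, hsplit H, h.1, h.2]
  have hsum : (#𝒢 : ℝ) * x ^ g ≤ (x + x ^ 2) ^ m * (2 + 8 * g * (D + 1) ^ 2 * 4 ^ (D + 1)) := by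
    refine le_trans ?_ (sum_pow_card_le_of_good hm hDm (𝒢 := 𝒢)
      (fun G hG => (mem_filter.1 hG).2.1) (fun G hG => (mem_filter.1 hG).2.2.1)
      (fun G hG => (mem_filter.1 hG).2.2.2) hx hx')
    rw [← nsmul_eq_mul, ← sum_const]
    exact sum_le_sum fun G hG =>
      pow_le_pow_of_le_one hx0.le (by linarith) (mem_filter.1 hG).2.2.1
  calc #(gapsets m g) * x ^ g
      ≤ (#{T ∈ (range (2 * g)).powerset | #T ≤ 2 * J} * #𝒢 : ℕ) * x ^ g := by gcongr
    _ = #{T ∈ (range (2 * g)).powerset | #T ≤ 2 * J} * (#𝒢 * x ^ g) := by push_cast; ring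
    _ ≤ ((2 * J + 1) * (2 * g + 1) ^ (2 * J) : ℕ) * (#𝒢 * x ^ g) := by
        gcongr
        exact card_filter_card_le_le _ _
    _ ≤ ((2 * J + 1) * (2 * g + 1) ^ (2 * J) : ℕ) *
          ((x + x ^ 2) ^ m * (2 + 8 * g * (D + 1) ^ 2 * 4 ^ (D + 1))) := by gcongr
    _ = _ := by push_cast; rfl

/-- A crude bound on the number of gap sets, which suffices for small multiplicities. -/
theorem card_gapsets_mul_pow_le_pow (m g : ℕ) {x : ℝ} (hx : 0 ≤ x) (hx' : x < 1) :
    #(gapsets m g) * x ^ g ≤ (1 / (1 - x)) ^ m := by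
  have hk : ∀ G ∈ gapsets m g, ∀ i < m, kunz m G i < g + 1 := by
    intro G hG i hi
    rw [mem_gapsets] at hG
    rw [Nat.lt_succ_iff, ← hG.2, hG.1.card_eq_sum_kunz]
    exact single_le_sum (fun _ _ => Nat.zero_le _) (mem_range.2 hi)
  let φ : Finset ℕ → Fin m → Fin (g + 1) := fun G i => Fin.ofNat (g + 1) (kunz m G i)
  have hφ : ∀ G ∈ gapsets m g, ∀ i, (φ G i : ℕ) = kunz m G i := fun G hG i =>
    Nat.mod_eq_of_lt (hk G hG i i.2)
  calc #(gapsets m g) * x ^ g = ∑ G ∈ gapsets m g, x ^ g := by rw [sum_const, nsmul_eq_mul]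
    _ = ∑ G ∈ gapsets m g, ∏ i, x ^ (φ G i : ℕ) := by
        refine sum_congr rfl fun G hG => ?_
        simp_rw [hφ G hG]
        rw [mem_gapsets] at hG
        rw [prod_pow_eq_pow_sum, Fin.sum_univ_eq_sum_range (fun i => kunz m G i),
          ← hG.1.card_eq_sum_kunz, hG.2]
    _ ≤ ∑ w : Fin m → Fin (g + 1), ∏ i, x ^ (w i : ℕ) := by
        refine sum_comp_le_sum_of_injOn φ (fun _ _ => mem_univ _) ?_
          (f := fun w => ∏ i, x ^ (w i : ℕ)) fun _ _ => by positivity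
        intro G hG H hH h
        refine (mem_gapsets.1 hG).1.ext_kunz (mem_gapsets.1 hH).1 fun i hi => ?_
        have h1 := hφ G hG ⟨i, hi⟩
        rw [h, hφ H hH ⟨i, hi⟩] at h1
        exact h1.symm
    _ = (∑ a : Fin (g + 1), x ^ (a : ℕ)) ^ m :=
        (Fintype.sum_pow (fun a : Fin (g + 1) => x ^ (a : ℕ)) m).symm
    _ ≤ _ := by
        have h1 : 0 ≤ ∑ a : Fin (g + 1), x ^ (a : ℕ) := by positivity
        gcongr
        rw [Fin.sum_univ_eq_sum_range (fun a => x ^ a), range_eq_Ico]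
        simpa using geom_sum_Ico_le_of_lt_one (m := 0) (n := g + 1) hx hx'

end Counting

section Semigroups

open Finset

theorem IsGapset.multiplicity_unique {m n : ℕ} {G : Finset ℕ} (hm : IsGapset m G)
    (hn : IsGapset n G) : m = n := by
  rcases lt_trichotomy m n with h | h | h
  · exact absurd (hn.mem_of_lt hm.pos h) hm.notMem
  · exact h
  · exact absurd (hm.mem_of_lt hn.pos h) hn.notMem

namespace NumericalSemigroup

/-- The finite set of gaps. -/
noncomputable def gaps (S : NumericalSemigroup) : Finset ℕ := S.cofinite.toFinset

theorem mem_gaps {S : NumericalSemigroup} {a : ℕ} : a ∈ S.gaps ↔ a ∉ S.carrier := by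
  simp [gaps]

theorem card_gaps (S : NumericalSemigroup) : #S.gaps = S.genus :=
  (Set.ncard_eq_toFinset_card _ S.cofinite).symm

theorem gaps_injective : Function.Injective gaps := by
  rintro ⟨A, _, _, hA⟩ ⟨B, _, _, hB⟩ h
  have : Aᶜ = Bᶜ := by simpa [gaps] using h
  simpa using this

theorem isGapset_gaps (S : NumericalSemigroup) : IsGapset S.multiplicity S.gaps := by
  have hne : {n : ℕ | n ∈ S.carrier ∧ n ≠ 0}.Nonempty := by
    obtain ⟨n, hn⟩ := Infinite.exists_notMem_finset (insert 0 S.gaps)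
    rw [mem_insert, not_or, mem_gaps, not_not] at hn
    exact ⟨n, hn.2, hn.1⟩
  have hmem : S.multiplicity ∈ S.carrier ∧ S.multiplicity ≠ 0 := Nat.sInf_mem hne
  refine ⟨Nat.pos_of_ne_zero hmem.2, ?_, ?_, ?_, ?_⟩
  · simpa [mem_gaps] using S.zero_mem
  · intro a b ha hb
    rw [mem_gaps, not_not] at *
    exact S.add_mem ha hb
  · simpa [mem_gaps] using hmem.1
  · intro i hi him
    rw [mem_gaps]
    intro h
    exact absurd (Nat.sInf_le (s := {n : ℕ | n ∈ S.carrier ∧ n ≠ 0}) ⟨h, hi.ne'⟩) (not_le.2 him)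

theorem exists_gaps_eq {m : ℕ} {G : Finset ℕ} (hG : IsGapset m G) :
    ∃ S : NumericalSemigroup, S.gaps = G := by
  refine ⟨⟨(G : Set ℕ)ᶜ, ?_, ?_, ?_⟩, ?_⟩
  · simpa using hG.zero_notMem
  · intro a b ha hb
    exact hG.add_notMem ha hb
  · rw [compl_compl]
    exact G.finite_toSet
  · ext a
    simp [mem_gaps]

theorem ncard_setOf_genus_eq (g : ℕ) (p : ℕ → Prop) [DecidablePred p] :
    {S : NumericalSemigroup | S.genus = g ∧ p S.multiplicity}.ncard =
      ∑ m ∈ range (g + 2) with p m, #(gapsets m g) := by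
  rw [← Set.ncard_image_of_injective _ gaps_injective, ← card_biUnion, ← Set.ncard_coe_finset]
  · congr 1
    ext G
    simp only [Set.mem_image, Set.mem_ofPred_eq, mem_coe, mem_biUnion, mem_filter, mem_range,
      mem_gapsets]
    constructor
    · rintro ⟨S, ⟨hg, hp⟩, rfl⟩
      have h := S.isGapset_gaps
      have hm := h.le_card_add_one
      rw [card_gaps] at hm ⊢
      exact ⟨S.multiplicity, ⟨by omega, hp⟩, h, hg⟩
    · rintro ⟨m, ⟨-, hp⟩, hG, hg⟩
      obtain ⟨S, rfl⟩ := exists_gaps_eq hG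
      refine ⟨S, ⟨by rw [← card_gaps, hg], ?_⟩, rfl⟩
      rwa [S.isGapset_gaps.multiplicity_unique hG]
  · intro m _ n _ hmn
    refine disjoint_left.2 fun G hG hG' => ?_
    exact hmn ((mem_gapsets.1 hG).1.multiplicity_unique (mem_gapsets.1 hG').1)

end NumericalSemigroup

theorem choose_le_card_gapsets (i j : ℕ) : i.choose j ≤ #(gapsets (i + 1) (i + j)) := by
  have hcard : #(Ioo (i + 1) (2 * i + 2)) = i := by
    rw [Nat.card_Ioo]
    omega
  have hdisj : ∀ B ⊆ Ioo (i + 1) (2 * i + 2), Disjoint (Ioo 0 (i + 1)) B := by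
    intro B hB
    rw [disjoint_left]
    intro a ha ha'
    have := mem_Ioo.1 ha
    have := mem_Ioo.1 (hB ha')
    omega
  rw [← hcard, ← card_powersetCard, hcard]
  refine card_le_card_of_injOn (fun B => Ioo 0 (i + 1) ∪ B) ?_ ?_
  · intro B hB
    obtain ⟨hB, hBj⟩ := mem_powersetCard.1 hB
    rw [mem_coe, mem_gapsets]
    have hmem : ∀ a ∈ Ioo 0 (i + 1) ∪ B, 0 < a ∧ a ≠ i + 1 ∧ a < 2 * i + 2 := by
      intro a ha
      rcases mem_union.1 ha with ha | ha
      · have := mem_Ioo.1 ha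
        omega
      · have := mem_Ioo.1 (hB ha)
        omega
    have hsmall : ∀ a, 0 < a → a < i + 1 → a ∈ Ioo 0 (i + 1) ∪ B := fun a h h' =>
      mem_union_left _ (mem_Ioo.2 ⟨h, h'⟩)
    refine ⟨⟨by omega, fun h => (hmem _ h).1.ne rfl, ?_, fun h => (hmem _ h).2.1 rfl, hsmall⟩, ?_⟩
    · intro a b ha hb h
      have h1 := (hmem _ h).2.2
      rcases Nat.eq_zero_or_pos a with rfl | ha0
      · rw [zero_add] at h
        exact hb h
      rcases Nat.eq_zero_or_pos b with rfl | hb0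
      · exact ha h
      have h2 : i + 1 ≤ a := not_lt.1 fun h => ha (hsmall a ha0 h)
      have h3 : i + 1 ≤ b := not_lt.1 fun h => hb (hsmall b hb0 h)
      omega
    · rw [card_union_of_disjoint (hdisj B hB), hBj, Nat.card_Ioo]
      omega
  · intro B hB C hC h
    have h1 := hdisj B (mem_powersetCard.1 hB).1
    have h2 := hdisj C (mem_powersetCard.1 hC).1
    rw [← union_sdiff_cancel_left h1, ← union_sdiff_cancel_left h2]
    exact congrArg (· \ Ioo 0 (i + 1)) h

theorem fib_le_sum_card_gapsets (g : ℕ) :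
    Nat.fib (g + 1) ≤ ∑ m ∈ range (g + 2), #(gapsets m g) := by
  rw [Nat.fib_succ_eq_sum_choose, Nat.sum_antidiagonal_eq_sum_range_succ Nat.choose,
    sum_range_succ' _ (g + 1)]
  refine le_add_right (sum_le_sum fun i hi => ?_)
  have := choose_le_card_gapsets i (g - i)
  rwa [Nat.add_sub_cancel' (Nat.lt_succ_iff.1 (mem_range.1 hi))] at this

theorem goldenRatio_pow_le_two_mul_fib (n : ℕ) :
    Real.goldenRatio ^ n ≤ 2 * Nat.fib (n + 1) := by
  induction n using Nat.twoStepInduction with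
  | zero => norm_num
  | one => simpa using Real.goldenRatio_lt_two.le
  | more n h1 h2 =>
    rw [Nat.fib_add_two, pow_add, Real.goldenRatio_sq]
    rw [pow_succ] at h2
    push_cast
    linarith

end Semigroups

section Asymptotics

open Finset Filter Topology Real

/-- Uniformly over the pairs `(m, g)` with `p m g`, the number of numerical semigroups of
multiplicity `m` and genus `g` grows at a rate below the golden ratio. -/
def IsExpNegligible (p : ℕ → ℕ → Prop) : Prop :=
  ∃ (k : ℕ) (C q : ℝ), 0 < q ∧ q < goldenRatio ∧
    ∀ g m, p m g → #(gapsets m g) ≤ C * (g + 1) ^ k * q ^ g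

theorem IsExpNegligible.mono {p p' : ℕ → ℕ → Prop} (hp : IsExpNegligible p)
    (h : ∀ g m, p' m g → p m g) : IsExpNegligible p' := by
  obtain ⟨k, C, q, hq, hq', hC⟩ := hp
  exact ⟨k, C, q, hq, hq', fun g m hm => hC g m (h g m hm)⟩

open Classical in
theorem IsExpNegligible.tendsto {p : ℕ → ℕ → Prop} (hp : IsExpNegligible p) :
    Tendsto (fun g : ℕ => (∑ m ∈ range (g + 2) with p m g, (#(gapsets m g) : ℝ)) /
      goldenRatio ^ g) atTop (𝓝 0) := by
  obtain ⟨k, C, q, hq, hq', hC⟩ := hp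
  have hφ := goldenRatio_pos
  set r := q / goldenRatio with hr
  have hr0 : 0 < r := by positivity
  have hr1 : r < 1 := (div_lt_one hφ).2 hq'
  have hlim : Tendsto (fun g : ℕ => (2 * |C| * r⁻¹) * (((g + 1 : ℕ) : ℝ) ^ (k + 1) * r ^ (g + 1)))
      atTop (𝓝 0) := by
    have h := (tendsto_add_atTop_iff_nat 1).2 (tendsto_pow_const_mul_const_pow_of_abs_lt_one
      (k + 1) (by rwa [abs_of_pos hr0]))
    have h' := h.const_mul (2 * |C| * r⁻¹)
    rwa [mul_zero] at h'
  refine squeeze_zero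
    (fun g => div_nonneg (sum_nonneg fun _ _ => Nat.cast_nonneg _) (pow_nonneg hφ.le _))
    (fun g => ?_) hlim
  rw [div_le_iff₀ (pow_pos hφ _)]
  calc ∑ m ∈ range (g + 2) with p m g, (#(gapsets m g) : ℝ)
      ≤ ∑ m ∈ range (g + 2) with p m g, |C| * (g + 1) ^ k * q ^ g := by
        refine sum_le_sum fun m hm => (hC g m (mem_filter.1 hm).2).trans ?_
        gcongr
        exact le_abs_self C
    _ ≤ ∑ m ∈ range (g + 2), |C| * (g + 1) ^ k * q ^ g :=
        sum_le_sum_of_subset_of_nonneg (filter_subset _ _) fun _ _ _ => by positivity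
    _ = (g + 2) * (|C| * (g + 1) ^ k * q ^ g) := by simp
    _ ≤ (2 * (g + 1)) * (|C| * (g + 1) ^ k * q ^ g) := by
        gcongr
        linarith
    _ = _ := by
        have : q ^ g = r ^ g * goldenRatio ^ g := by
          rw [← mul_pow, hr, div_mul_cancel₀ _ hφ.ne']
        rw [this]
        push_cast
        field_simp
        ring

theorem isExpNegligible_small : IsExpNegligible fun m g => 10 * m ≤ g := by
  refine ⟨0, 1, 7 / 5, by norm_num, ?_, fun g m h => ?_⟩
  · rw [goldenRatio]
    have : (2 : ℝ) ≤ √5 := le_sqrt_of_sq_le (by norm_num)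
    linarith
  have h1 := card_gapsets_mul_pow_le_pow m g (x := 9 / 10) (by norm_num) (by norm_num)
  have h2 : (1 / (1 - 9 / 10 : ℝ)) ^ m ≤ (63 / 50) ^ g := by
    calc (1 / (1 - 9 / 10 : ℝ)) ^ m ≤ ((63 / 50) ^ 10) ^ m := by
          gcongr
          norm_num
      _ = (63 / 50) ^ (10 * m) := by rw [pow_mul]
      _ ≤ _ := pow_le_pow_right₀ (by norm_num) h
  rw [show (63 / 50 : ℝ) = 7 / 5 * (9 / 10) by norm_num, mul_pow] at h2
  simpa using le_of_mul_le_mul_right (h1.trans h2) (by positivity)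

theorem isExpNegligible_of_lt {x ρ : ℝ} (hx : 61 / 100 ≤ x) (hx' : x ≤ 31 / 50) (hρ : 0 < ρ)
    (h : x⁻¹ * ρ < goldenRatio) :
    IsExpNegligible fun m g => 0 < m ∧ g < 10 * m ∧ (x + x ^ 2) ^ m ≤ ρ ^ g := by
  have hx0 : 0 < x := by linarith
  obtain ⟨τ, hτ1, hτ⟩ : ∃ τ : ℝ, 1 < τ ∧ x⁻¹ * ρ * τ < goldenRatio := by
    obtain ⟨τ, h1, h2⟩ := exists_between ((one_lt_div (by positivity)).2 h)
    exact ⟨τ, h1, by rwa [lt_div_iff₀' (by positivity)] at h2⟩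
  obtain ⟨M, hM10, hM⟩ : ∃ M : ℕ, 10 ≤ M ∧ 4 ≤ τ ^ M := by
    obtain ⟨n, hn⟩ := pow_unbounded_of_one_lt 4 hτ1
    exact ⟨n + 10, by omega, hn.le.trans (pow_le_pow_right₀ hτ1.le (by omega))⟩
  refine ⟨4 * M + 3, (4 * M + 1) * 2 ^ (4 * M) * 34, x⁻¹ * ρ * τ, by positivity, hτ, ?_⟩
  rintro g m ⟨hm, hgm, hpow⟩
  set D := g / M with hD
  have hDg : D * 10 ≤ g := (Nat.mul_le_mul_left D hM10).trans (Nat.div_mul_le_self g M)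
  have hgD : g < (D + 1) * M := by
    rw [Nat.succ_mul]
    exact Nat.lt_div_mul_add (by omega)
  have key := card_gapsets_mul_pow_le (m := m) (g := g) (D := D) (J := 2 * M) hm (by omega)
    (by lia) hx hx'
  have h4 : (4 : ℝ) ^ D ≤ τ ^ g := by
    calc (4 : ℝ) ^ D ≤ (τ ^ M) ^ D := by gcongr
      _ = τ ^ (M * D) := by rw [pow_mul]
      _ ≤ τ ^ g := pow_le_pow_right₀ hτ1.le (Nat.mul_div_le g M)
  have hτg : 1 ≤ τ ^ g := one_le_pow₀ hτ1.le
  have hDg' : (D : ℝ) ≤ g := by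
    exact_mod_cast (by omega : D ≤ g)
  have hC : 2 + 8 * (g : ℝ) * (D + 1) ^ 2 * 4 ^ (D + 1) ≤ 34 * (g + 1) ^ 3 * τ ^ g := by
    calc 2 + 8 * (g : ℝ) * (D + 1) ^ 2 * 4 ^ (D + 1)
        = 2 + 32 * (g * (D + 1) ^ 2) * 4 ^ D := by ring
      _ ≤ 2 * (g + 1) ^ 3 * τ ^ g + 32 * ((g + 1) * (g + 1) ^ 2) * τ ^ g := by
          gcongr
          · have : (1 : ℝ) ≤ (g + 1) ^ 3 := one_le_pow₀ (by linarith [g.cast_nonneg (α := ℝ)])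
            nlinarith
          · linarith
      _ = _ := by ring
  have hfinal : #(gapsets m g) * x ^ g ≤
      (4 * M + 1) * 2 ^ (4 * M) * 34 * (g + 1) ^ (4 * M + 3) * (ρ * τ) ^ g := by
    refine key.trans ?_
    push_cast
    calc (2 * (2 * (M : ℝ)) + 1) * (2 * g + 1) ^ (2 * (2 * M)) *
          ((x + x ^ 2) ^ m * (2 + 8 * g * (D + 1) ^ 2 * 4 ^ (D + 1)))
        ≤ (2 * (2 * (M : ℝ)) + 1) * (2 * (g + 1)) ^ (2 * (2 * M)) *
          (ρ ^ g * (34 * (g + 1) ^ 3 * τ ^ g)) := by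
          gcongr
          linarith
      _ = _ := by
          rw [show 2 * (2 * M) = 4 * M by ring, mul_pow, mul_pow, pow_add]
          ring
  calc (#(gapsets m g) : ℝ) = #(gapsets m g) * x ^ g * (x⁻¹) ^ g := by
        rw [mul_assoc, ← mul_pow, mul_inv_cancel₀ hx0.ne', one_pow, mul_one]
    _ ≤ (4 * M + 1) * 2 ^ (4 * M) * 34 * (g + 1) ^ (4 * M + 3) * (ρ * τ) ^ g * (x⁻¹) ^ g := by
        gcongr
    _ = _ := by
        rw [mul_assoc, ← mul_pow]
        ring

theorem inv_goldenRatio_add_sq : goldenRatio⁻¹ + goldenRatio⁻¹ ^ 2 = 1 := by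
  rw [inv_goldenRatio, neg_sq, goldenConj_sq]
  ring

theorem hasDerivAt_logGrowth (a : ℝ) :
    HasDerivAt (fun x : ℝ => a * log (x + x ^ 2) - log x) ((a - gamma) * √5) goldenRatio⁻¹ := by
  have hφ := goldenRatio_pos
  have h0 : (0 : ℝ) < goldenRatio⁻¹ := by positivity
  have h1 : HasDerivAt (fun x : ℝ => x + x ^ 2) (1 + 2 * goldenRatio⁻¹) goldenRatio⁻¹ :=
    ((hasDerivAt_id' goldenRatio⁻¹).add (hasDerivAt_pow 2 goldenRatio⁻¹)).congr_deriv (by ring)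
  have h2 := ((h1.log (by rw [inv_goldenRatio_add_sq]; exact one_ne_zero)).const_mul a).sub
    (hasDerivAt_log h0.ne')
  refine h2.congr_deriv ?_
  rw [inv_goldenRatio_add_sq, inv_inv, inv_goldenRatio, gamma, goldenRatio, goldenConj]
  have : √5 * √5 = 5 := mul_self_sqrt (by norm_num)
  linear_combination (1 / 10) * this

theorem inv_mul_rpow_lt {a x : ℝ} (hx : 0 < x)
    (h : a * log (x + x ^ 2) - log x < a * log (goldenRatio⁻¹ + goldenRatio⁻¹ ^ 2) -
      log goldenRatio⁻¹) : x⁻¹ * (x + x ^ 2) ^ a < goldenRatio := by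
  have hφ := goldenRatio_pos
  rw [inv_goldenRatio_add_sq, log_one, mul_zero, zero_sub, log_inv, neg_neg] at h
  rw [← log_lt_log_iff (by positivity) hφ, log_mul (by positivity) (by positivity), log_inv,
    log_rpow (by positivity)]
  linarith

theorem inv_goldenRatio_mem_Ioo : goldenRatio⁻¹ ∈ Set.Ioo (61 / 100 : ℝ) (31 / 50) := by
  have h1 : (222 / 100 : ℝ) < √5 := lt_sqrt_of_sq_lt (by norm_num)
  have h2 : √5 < (224 / 100 : ℝ) := (sqrt_lt' (by norm_num)).2 (by norm_num)
  rw [inv_goldenRatio, goldenConj]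
  constructor <;> linarith

theorem isExpNegligible_of_gamma_lt {a : ℝ} (ha : gamma < a) :
    IsExpNegligible fun m g => 0 < m ∧ g < 10 * m ∧ a * g ≤ m := by
  have hψ := inv_goldenRatio_mem_Ioo
  have hslope := (hasDerivAt_logGrowth a).tendsto_slope.eventually
    (lt_mem_nhds (mul_pos (sub_pos.2 ha) (sqrt_pos.2 (by norm_num : (0 : ℝ) < 5))))
  obtain ⟨x, hx, hxI⟩ := ((hslope.filter_mono (nhdsLT_le_nhdsNE _)).and
    (Ioo_mem_nhdsLT hψ.1)).exists
  have hx0 : 0 < x := by linarith [hxI.1]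
  have hr : x + x ^ 2 ≤ 1 := by
    rw [← inv_goldenRatio_add_sq]
    have := hxI.2.le
    gcongr
  rw [slope_def_field] at hx
  rcases div_pos_iff.1 hx with ⟨-, h⟩ | ⟨h, -⟩
  · linarith [hxI.2]
  refine (isExpNegligible_of_lt hxI.1.le (hxI.2.le.trans hψ.2.le) (ρ := (x + x ^ 2) ^ a)
    (by positivity) (inv_mul_rpow_lt hx0 (sub_neg.1 h))).mono ?_
  rintro g m ⟨hm, hgm, h⟩
  refine ⟨hm, hgm, ?_⟩
  rw [← rpow_natCast (x + x ^ 2) m, ← rpow_natCast _ g, ← rpow_mul (by positivity)]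
  exact rpow_le_rpow_of_exponent_ge (by positivity) hr h

theorem isExpNegligible_of_lt_gamma {a : ℝ} (ha : a < gamma) :
    IsExpNegligible fun m g => 0 < m ∧ g < 10 * m ∧ m ≤ a * g := by
  have hψ := inv_goldenRatio_mem_Ioo
  have hslope := (hasDerivAt_logGrowth a).tendsto_slope.eventually (gt_mem_nhds
    (mul_neg_of_neg_of_pos (sub_neg.2 ha) (sqrt_pos.2 (by norm_num : (0 : ℝ) < 5))))
  obtain ⟨x, hx, hxI⟩ := ((hslope.filter_mono (nhdsGT_le_nhdsNE _)).and
    (Ioo_mem_nhdsGT hψ.2)).exists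
  have hx0 : 0 < x := by linarith [hxI.1, hψ.1]
  have hr : 1 ≤ x + x ^ 2 := by
    rw [← inv_goldenRatio_add_sq]
    have := hxI.1.le
    have := goldenRatio_pos
    gcongr
  rw [slope_def_field] at hx
  rcases div_neg_iff.1 hx with ⟨-, h⟩ | ⟨h, -⟩
  · linarith [hxI.1]
  refine (isExpNegligible_of_lt (hψ.1.le.trans hxI.1.le) hxI.2.le (ρ := (x + x ^ 2) ^ a)
    (by positivity) (inv_mul_rpow_lt hx0 (sub_neg.1 h))).mono ?_
  rintro g m ⟨hm, hgm, h⟩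
  refine ⟨hm, hgm, ?_⟩
  rw [← rpow_natCast (x + x ^ 2) m, ← rpow_natCast _ g, ← rpow_mul (by positivity)]
  exact rpow_le_rpow_of_exponent_le hr h

end Asymptotics

theorem portion_multiplicity_near_gamma (ε₁ : ℝ) (hε₁ : 0 < ε₁) :
    Filter.Tendsto
      (fun g : ℕ =>
        (({S : NumericalSemigroup | S.genus = g ∧
            (gamma - ε₁) * g < (S.multiplicity : ℝ) ∧
            (S.multiplicity : ℝ) < (gamma + ε₁) * g}.ncard : ℝ)) /
          ({S : NumericalSemigroup | S.genus = g}.ncard : ℝ))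
      Filter.atTop (nhds 1) := by
  classical
  open Finset Real in
  let near : ℕ → ℕ → Prop := fun m g => (gamma - ε₁) * g < m ∧ (m : ℝ) < (gamma + ε₁) * g
  let small : ℕ → ℕ → Prop := fun m g => 10 * m ≤ g
  let low : ℕ → ℕ → Prop := fun m g => 0 < m ∧ g < 10 * m ∧ m ≤ (gamma - ε₁) * g
  let high : ℕ → ℕ → Prop := fun m g => 0 < m ∧ g < 10 * m ∧ (gamma + ε₁) * g ≤ m
  let N : (ℕ → ℕ → Prop) → ℕ → ℝ := fun p g =>
    ∑ m ∈ range (g + 2) with p m g, (#(gapsets m g) : ℝ)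
  have hnear : ∀ g : ℕ, ({S : NumericalSemigroup | S.genus = g ∧
      (gamma - ε₁) * g < (S.multiplicity : ℝ) ∧
      (S.multiplicity : ℝ) < (gamma + ε₁) * g}.ncard : ℝ) = N near g := by
    intro g
    simp only [N]
    rw [← Nat.cast_sum]
    congr 1
    convert NumericalSemigroup.ncard_setOf_genus_eq g (near · g)
  have hall : ∀ g : ℕ, ({S : NumericalSemigroup | S.genus = g}.ncard : ℝ) =
      ∑ m ∈ range (g + 2), (#(gapsets m g) : ℝ) := by
    intro g
    have h := NumericalSemigroup.ncard_setOf_genus_eq g fun _ => True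
    simp only [and_true, filter_true] at h
    exact_mod_cast congrArg (Nat.cast (R := ℝ)) h
  have hpos : ∀ g : ℕ, goldenRatio ^ g / 2 ≤ ∑ m ∈ range (g + 2), (#(gapsets m g) : ℝ) := by
    intro g
    have h1 : (Nat.fib (g + 1) : ℝ) ≤ ∑ m ∈ range (g + 2), (#(gapsets m g) : ℝ) := by
      exact_mod_cast fib_le_sum_card_gapsets g
    linarith [goldenRatio_pow_le_two_mul_fib g]
  have hbad : ∀ g : ℕ, ∑ m ∈ range (g + 2), (#(gapsets m g) : ℝ) ≤
      N near g + (N small g + N low g + N high g) := by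
    intro g
    simp only [N, sum_filter, ← sum_add_distrib]
    refine sum_le_sum fun m _ => ?_
    have h0 : (0 : ℝ) ≤ #(gapsets m g) := Nat.cast_nonneg _
    have hcover : near m g ∨ small m g ∨ low m g ∨ high m g := by
      by_cases h1 : 10 * m ≤ g
      · exact Or.inr (Or.inl h1)
      by_cases h2 : (gamma - ε₁) * g < m
      · by_cases h3 : (m : ℝ) < (gamma + ε₁) * g
        · exact Or.inl ⟨h2, h3⟩
        · exact Or.inr (Or.inr (Or.inr ⟨by omega, by omega, not_lt.1 h3⟩))
      · exact Or.inr (Or.inr (Or.inl ⟨by omega, by omega, not_lt.1 h2⟩))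
    split_ifs <;> first | linarith | (exfalso; tauto)
  have hlim : Filter.Tendsto (fun g : ℕ => 1 - 2 * (N small g / goldenRatio ^ g +
      N low g / goldenRatio ^ g + N high g / goldenRatio ^ g)) Filter.atTop (nhds 1) := by
    have h := ((isExpNegligible_small.tendsto.add
      (isExpNegligible_of_lt_gamma (sub_lt_self gamma hε₁)).tendsto).add
      (isExpNegligible_of_gamma_lt (lt_add_of_pos_right gamma hε₁)).tendsto).const_mul 2
    have h' := h.const_sub 1
    simp only [add_zero, mul_zero, sub_zero] at h'
    exact h'
  have hN : ∀ p g, 0 ≤ N p g := fun p g => sum_nonneg fun _ _ => Nat.cast_nonneg _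
  have hle : ∀ p g, N p g ≤ ∑ m ∈ range (g + 2), (#(gapsets m g) : ℝ) := fun p g =>
    sum_le_sum_of_subset_of_nonneg (filter_subset _ _) fun _ _ _ => Nat.cast_nonneg _
  simp only [hnear, hall]
  refine tendsto_of_tendsto_of_tendsto_of_le_of_le hlim tendsto_const_nhds (fun g => ?_)
    fun g => ?_
  · have hφ : 0 < goldenRatio ^ g := pow_pos goldenRatio_pos g
    have hn := hpos g
    have hb := hbad g
    have hb0 := add_nonneg (add_nonneg (hN small g) (hN low g)) (hN high g)
    simp only [← add_div]
    generalize N small g + N low g + N high g = b at *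
    generalize ∑ m ∈ range (g + 2), (#(gapsets m g) : ℝ) = n at *
    generalize goldenRatio ^ g = c at *
    have h1 : b ≤ 2 * (b / c) * n := by
      calc b = 2 * (b / c) * (c / 2) := by field_simp
        _ ≤ _ := by gcongr
    rw [le_div_iff₀ (by linarith)]
    linarith
  · exact div_le_one_of_le₀ (hle near g) (sum_nonneg fun _ _ => Nat.cast_nonneg _)
end

section
/- For every fixed real number ε₂ > 0, the proportion of numerical semigroups S of genus g whose Frobenius number F(S) satisfies (2 − ε₂)·m(S) < F(S) < (2 + ε₂)·m(S), among all numerical semigroups of genus g, tends to 1 as g → ∞. That is, with A_g^F(ε₂) = {S of genus g : (2 − ε₂)m(S) < F(S) < (2 + ε₂)m(S)}, one has lim_{g→∞} #A_g^F(ε₂)/n_g = 1. -/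
namespace Kunz

open Finset

theorem sum_pow_le_inv {y : ℝ} (h0 : 0 ≤ y) (h1 : y < 1) (s : Finset ℕ) :
    ∑ k ∈ s, y ^ k ≤ (1 - y)⁻¹ := by
  rw [← tsum_geometric_of_lt_one h0 h1]
  exact (summable_geometric_of_lt_one h0 h1).sum_le_tsum s (fun _ _ => by positivity)

theorem sum_le_sum_sum_filter {α β : Type*} (s : Finset α) (t : Finset β)
    (r : β → α → Prop) [∀ b a, Decidable (r b a)] (g : α → ℝ) (hg : ∀ a ∈ s, 0 ≤ g a)
    (h : ∀ a ∈ s, ∃ b ∈ t, r b a) :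
    ∑ a ∈ s, g a ≤ ∑ b ∈ t, ∑ a ∈ s with r b a, g a := by
  simp_rw [Finset.sum_filter]
  rw [Finset.sum_comm]
  refine Finset.sum_le_sum fun a ha => ?_
  obtain ⟨b, hb, hr⟩ := h a ha
  have := Finset.single_le_sum (f := fun b => if r b a then g a else 0)
    (fun b _ => by split_ifs <;> simp [hg a ha]) hb
  simpa [hr] using this

theorem golden_bounds {x : ℝ} (h0 : 0 < x) (hx : x + x ^ 2 = 1) : 0.618 < x ∧ x < 0.6181 := by
  constructor <;> nlinarith

theorem sum_pow_le_three {x : ℝ} (h0 : 0 < x) (hx : x + x ^ 2 = 1) (s : Finset ℕ) :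
    ∑ k ∈ s, x ^ k ≤ 3 := by
  obtain ⟨h1, h2⟩ := golden_bounds h0 hx
  refine (sum_pow_le_inv h0.le (by linarith) s).trans ?_
  rw [inv_le_comm₀ (by linarith) (by norm_num)]
  linarith

/-- If every configuration of lower bounds violating few pair constraints has total weight at most
`M`, then the weight of all functions satisfying the pair constraints is only slightly larger. -/
theorem sum_prod_le_of_branching {V J : Type*} [Fintype V] [DecidableEq V] [Fintype J]
    {x z M : ℝ} (hx : 0 ≤ x) (hz : 1 ≤ z) (hM0 : 0 ≤ M) {d : ℕ} (hd : z⁻¹ + z⁻¹ ^ d ≤ 1)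
    {Q : ℕ} {R : V → Finset ℕ} (hR : ∀ v, ∀ k ∈ R v, k ≤ Q) {σ : J → V → V}
    (hσ : ∀ v, Function.Injective fun j => σ j v) (c : J → V → ℕ) (L : V → ℕ)
    (hM : ∀ l : V → ℕ, (∀ v, L v ≤ l v) → (∀ v, #{j | l v + l (σ j v) < c j v} < d) →
      ∏ v, ∑ k ∈ R v with l v ≤ k, x ^ k ≤ M)
    (l : V → ℕ) (hl : ∀ v, L v ≤ l v) :
    ∑ k ∈ Fintype.piFinset (fun v => {a ∈ R v | l v ≤ a}) with
      ∀ j v, c j v ≤ k v + k (σ j v), ∏ v, x ^ k v ≤ z ^ (∑ v, (Q + 1 - l v)) * M := by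
  have hz0 : 0 < z := by linarith
  induction hn : ∑ v, (Q + 1 - l v) using Nat.strong_induction_on generalizing l with
  | _ n ih =>
  by_cases hQ : ∃ v, Q < l v
  · obtain ⟨v, hv⟩ := hQ
    have : Fintype.piFinset (fun v => {a ∈ R v | l v ≤ a}) = ∅ := by
      rw [Fintype.piFinset_eq_empty]
      refine ⟨v, ?_⟩
      rw [Finset.filter_eq_empty_iff]
      intro k hk h
      have := hR v k hk
      omega
    rw [this]
    simp only [Finset.filter_empty, Finset.sum_empty]
    positivity
  push Not at hQ
  by_cases hT : ∀ v, #{j | l v + l (σ j v) < c j v} < d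
  · calc _ ≤ ∑ k ∈ Fintype.piFinset (fun v => {a ∈ R v | l v ≤ a}), ∏ v, x ^ k v :=
          Finset.sum_le_sum_of_subset_of_nonneg (Finset.filter_subset _ _)
            (fun _ _ _ => Finset.prod_nonneg fun _ _ => by positivity)
      _ = ∏ v, ∑ k ∈ R v with l v ≤ k, x ^ k := (Finset.prod_univ_sum _ _).symm
      _ ≤ M := hM l hl hT
      _ ≤ z ^ n * M := le_mul_of_one_le_left hM0 (one_le_pow₀ hz)
  push Not at hT
  obtain ⟨v, hv⟩ := hT
  set B : Finset V := ({j | l v + l (σ j v) < c j v} : Finset J).image (fun j => σ j v) with hB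
  have hBc : d ≤ #B := by rwa [hB, Finset.card_image_of_injective _ (hσ v)]
  have key : ∀ A : Finset V, A.Nonempty →
      ∑ k ∈ Fintype.piFinset (fun v => {a ∈ R v | l v + (if v ∈ A then 1 else 0) ≤ a}) with
        ∀ j v, c j v ≤ k v + k (σ j v), ∏ v, x ^ k v ≤ z⁻¹ ^ #A * (z ^ n * M) := by
    intro A hA
    have hs : ∑ v, (Q + 1 - (l v + if v ∈ A then 1 else 0)) + #A = n := by
      have hc : #A = ∑ v, if v ∈ A then 1 else 0 := by simp
      rw [← hn, hc, ← Finset.sum_add_distrib]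
      refine Finset.sum_congr rfl fun w _ => ?_
      have := hQ w
      split_ifs <;> omega
    have hpos := hA.card_pos
    refine (ih _ (by omega) _ (fun w => (hl w).trans (Nat.le_add_right _ _)) rfl).trans
      (le_of_eq ?_)
    rw [← hs, pow_add, inv_pow]
    field_simp
  have hsplit : ∑ k ∈ Fintype.piFinset (fun v => {a ∈ R v | l v ≤ a}) with
      ∀ j v, c j v ≤ k v + k (σ j v), ∏ v, x ^ k v ≤
      (∑ k ∈ Fintype.piFinset (fun w => {a ∈ R w | l w + (if w ∈ ({v} : Finset V) then 1 else 0) ≤ a})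
        with ∀ j v, c j v ≤ k v + k (σ j v), ∏ v, x ^ k v) +
      (∑ k ∈ Fintype.piFinset (fun w => {a ∈ R w | l w + (if w ∈ B then 1 else 0) ≤ a})
        with ∀ j v, c j v ≤ k v + k (σ j v), ∏ v, x ^ k v) := by
    rw [← Finset.sum_union_inter]
    refine le_add_of_le_of_nonneg ?_ (Finset.sum_nonneg fun _ _ => Finset.prod_nonneg fun _ _ => by positivity)
    refine Finset.sum_le_sum_of_subset_of_nonneg ?_
      (fun _ _ _ => Finset.prod_nonneg fun _ _ => by positivity)
    intro k hk
    simp only [Finset.mem_filter, Fintype.mem_piFinset, Finset.mem_union, Finset.mem_singleton] at hk ⊢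
    by_cases hkv : k v = l v
    · right
      refine ⟨fun w => ⟨(hk.1 w).1, ?_⟩, hk.2⟩
      split_ifs with hw
      · simp only [hB, Finset.mem_image, Finset.mem_filter, Finset.mem_univ, true_and] at hw
        obtain ⟨j, hj, rfl⟩ := hw
        have := hk.2 j v
        omega
      · exact (hk.1 w).2
    · left
      refine ⟨fun w => ⟨(hk.1 w).1, ?_⟩, hk.2⟩
      have := (hk.1 w).2
      split_ifs with hw
      · subst hw; omega
      · exact this
  have hzi : z⁻¹ ≤ 1 := inv_le_one_of_one_le₀ hz
  have hW : 0 ≤ z ^ n * M := by positivity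
  rcases B.eq_empty_or_nonempty with hBe | hBn
  · have : d = 0 := by simpa [hBe] using hBc
    rw [this, pow_zero] at hd
    have : 0 < z⁻¹ := by positivity
    linarith
  · refine hsplit.trans ((add_le_add (key {v} (by simp)) (key B hBn)).trans ?_)
    rw [← add_mul]
    refine mul_le_of_le_one_left hW (le_trans ?_ hd)
    simp only [Finset.card_singleton, pow_one]
    exact add_le_add le_rfl (pow_le_pow_of_le_one (by positivity) hzi hBc)

theorem sum_Icc_pow_mul_sq_le {x : ℝ} (h0 : 0 < x) (hx : x + x ^ 2 = 1) (a p : ℕ) :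
    (∑ k ∈ Icc a p, x ^ k) * x ^ 2 ≤ x ^ a := by
  rcases le_or_gt a (p + 1) with h | h
  · have := geom_sum_Ico_mul x h
    rw [Finset.Ico_add_one_right_eq_Icc] at this
    have h2 : 0 < x ^ (p + 1) := by positivity
    have h3 : x ^ 2 = -(x - 1) := by linarith
    rw [h3, mul_neg, this]
    linarith
  · rw [Finset.Icc_eq_empty (by omega)]
    simpa using by positivity

theorem pair_weight_le {x : ℝ} (h0 : 0 < x) (hx : x + x ^ 2 = 1) {p a b : ℕ} (hp : 3 ≤ p)
    (ha : 1 ≤ a) (hb : 1 ≤ b) (hab : p ≤ a + b) :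
    (∑ k ∈ Icc a p, x ^ k) * (∑ k ∈ Icc b p, x ^ k) ≤ 4 / 5 := by
  obtain ⟨h1, h2⟩ := golden_bounds h0 hx
  rcases lt_or_ge p a with h | hap
  · rw [Finset.Icc_eq_empty (by omega)]; norm_num
  rcases lt_or_ge p b with h | hbp
  · rw [Finset.Icc_eq_empty (a := b) (by omega)]; norm_num
  rcases le_or_gt 5 p with h5 | h5
  · have hA := sum_Icc_pow_mul_sq_le h0 hx a p
    have hB := sum_Icc_pow_mul_sq_le h0 hx b p
    have hm := mul_le_mul hA hB (by positivity) (by positivity)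
    rw [← pow_add] at hm
    have h3 : x ^ (a + b) ≤ x ^ 5 := pow_le_pow_of_le_one h0.le (by linarith) (by omega)
    have h4 : 0 < x ^ 4 := by positivity
    nlinarith
  · have e2 : x ^ 2 = 1 - x := by linarith
    have e3 : x ^ 3 = 2 * x - 1 := by linear_combination (x - 1) * hx
    have e4 : x ^ 4 = 2 - 3 * x := by linear_combination x * e3 + 2 * e2
    interval_cases p
    · interval_cases a <;> interval_cases b <;> first | omega |
        (simp [Finset.sum_Icc_succ_top, e2, e3]; nlinarith)
    · interval_cases a <;> interval_cases b <;> first | omega |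
        (simp [Finset.sum_Icc_succ_top, e2, e3, e4]; nlinarith)

theorem sum_Icc_two_le {x : ℝ} (h0 : 0 < x) (hx : x + x ^ 2 = 1) {a : ℕ} (ha : 1 ≤ a) :
    ∑ k ∈ Icc a 2, x ^ k ≤ 1 := by
  calc _ ≤ ∑ k ∈ Icc 1 2, x ^ k :=
        Finset.sum_le_sum_of_subset_of_nonneg (Finset.Icc_subset_Icc_left ha)
          (fun _ _ _ => by positivity)
    _ = 1 := by simp [Finset.sum_Icc_succ_top, hx]

/-- The residue `f - v` modulo `m`. -/
def reflect (m : ℕ) [NeZero m] (f : ℕ) (v : Fin m) : Fin m := Fin.ofNat m f - v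

/-- The lower bound for the sum of the Kunz coordinates at `v` and `f - v` when `f` is a gap. -/
def pairBound (m f : ℕ) (v : Fin m) : ℕ := f / m + if (v : ℕ) ≤ f % m then 1 else 0

section Reflect

variable {m : ℕ} [NeZero m]

theorem reflect_reflect (f : ℕ) (v : Fin m) : reflect m f (reflect m f v) = v := by
  simp [reflect]

theorem reflect_bijective (f : ℕ) : Function.Bijective (reflect m f) :=
  (show Function.Involutive (reflect m f) from reflect_reflect f).bijective

theorem val_reflect_of_le {f : ℕ} {v : Fin m} (h : (v : ℕ) ≤ f % m) :
    (reflect m f v : ℕ) = f % m - v := by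
  have hv := v.isLt
  have hs := Nat.mod_lt f (NeZero.pos m)
  rw [reflect, Fin.sub_def]
  simp only [Fin.val_ofNat]
  rw [show m - (v : ℕ) + f % m = f % m - v + m by omega, Nat.add_mod_right, Nat.mod_eq_of_lt]
  omega

theorem val_reflect_of_lt {f : ℕ} {v : Fin m} (h : f % m < v) :
    (reflect m f v : ℕ) = m + f % m - v := by
  have hv := v.isLt
  have hs := Nat.mod_lt f (NeZero.pos m)
  rw [reflect, Fin.sub_def]
  simp only [Fin.val_ofNat]
  rw [show m - (v : ℕ) + f % m = m + f % m - v by omega, Nat.mod_eq_of_lt]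
  omega

theorem reflect_le_iff (f : ℕ) (v : Fin m) :
    (reflect m f v : ℕ) ≤ f % m ↔ (v : ℕ) ≤ f % m := by
  have hv := v.isLt
  rcases le_or_gt (v : ℕ) (f % m) with h | h
  · rw [val_reflect_of_le h]; omega
  · rw [val_reflect_of_lt h]; omega

end Reflect

theorem card_fin_le_of_mem_Icc {m : ℕ} (s : Finset (Fin m)) (a b : ℕ)
    (h : ∀ v ∈ s, (v : ℕ) ∈ Icc a b) : #s ≤ b + 1 - a := by
  rw [← Nat.card_Icc]
  exact Finset.card_le_card_of_injOn _ h Fin.val_injective.injOn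

theorem pairBound_reflect {m : ℕ} [NeZero m] (f : ℕ) (v : Fin m) :
    pairBound m f (reflect m f v) = pairBound m f v := by
  simp [pairBound, reflect_le_iff]

theorem two_le_pairBound {m f : ℕ} [NeZero m] (hf : 2 * m ≤ f) (v : Fin m) :
    2 ≤ pairBound m f v := by
  have : 2 ≤ f / m := (Nat.le_div_iff_mul_le (NeZero.pos m)).2 hf
  unfold pairBound
  omega

/-- If `f ≥ 2m + b` and `b ≤ m`, then at least `b` residues have `pairBound m f v ≥ 3`. -/
theorem le_card_three_le_pairBound {m f b : ℕ} [NeZero m] (hf : 2 * m + b ≤ f) (hb : b ≤ m) :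
    b ≤ #{v : Fin m | 3 ≤ pairBound m f v} := by
  have hm := NeZero.pos m
  have h2 : 2 ≤ f / m := (Nat.le_div_iff_mul_le hm).2 (by omega)
  have hdm := Nat.div_add_mod f m
  rcases h2.eq_or_lt with h | h
  · rw [← h] at hdm
    have : (univ.map (Fin.castLEEmb hb)) ⊆ ({v : Fin m | 3 ≤ pairBound m f v} : Finset (Fin m)) := by
      intro v hv
      simp only [Finset.mem_map, Finset.mem_univ, true_and] at hv
      obtain ⟨u, rfl⟩ := hv
      have hu := u.isLt
      simp only [Finset.mem_filter, Finset.mem_univ, true_and, pairBound, ← h]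
      rw [if_pos (by simp; omega)]
    simpa using Finset.card_le_card this
  · have : ({v : Fin m | 3 ≤ pairBound m f v} : Finset (Fin m)) = univ :=
      Finset.filter_true_of_mem fun v _ => by unfold pairBound; omega
    rw [this]
    simpa using hb

theorem exists_card_mul_le {V : Type*} [Fintype V] {K d : ℕ} (hK : 0 < K)
    (r : Fin K → V → Prop) [∀ j v, Decidable (r j v)] (h : ∀ v, #{j | r j v} < d) :
    ∃ j, #{v | r j v} * K ≤ d * Fintype.card V := by
  by_contra! hc
  have h1 : ∑ j : Fin K, #{v | r j v} = ∑ v, #{j | r j v} :=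
    Finset.sum_card_bipartiteAbove_eq_sum_card_bipartiteBelow r
  have h2 : ∑ v, #{j | r j v} ≤ d * Fintype.card V := by
    refine (Finset.sum_le_sum fun v _ => (h v).le).trans ?_
    simp [mul_comm]
  have h3 : ∑ _j : Fin K, d * Fintype.card V < ∑ j : Fin K, #{v | r j v} * K :=
    Finset.sum_lt_sum_of_nonempty ⟨⟨0, hK⟩, by simp⟩ fun j _ => hc j
  have h4 : ∑ j : Fin K, #{v | r j v} * K = (∑ j : Fin K, #{v | r j v}) * K :=
    (Finset.sum_mul ..).symm
  rw [h4, h1, Finset.sum_const, Finset.card_univ, Fintype.card_fin, smul_eq_mul] at h3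
  nlinarith

theorem le_pairBound_of_lt {m f w k : ℕ} [NeZero m] {v : Fin m}
    (hk : k = 0 ∨ (k - 1) * m + v < f + w) (hw : w ≤ v) (hv : (v : ℕ) ≤ f % m ∨ f % m + w < v) :
    k ≤ pairBound m f v := by
  have hm := NeZero.pos m
  have hdm := Nat.div_add_mod f m
  have hs := Nat.mod_lt f hm
  rcases hk with rfl | hk
  · simp
  unfold pairBound
  rcases hv with h | h
  · rw [if_pos h]
    have : (k - 1) * m < (f / m + 1) * m := by
      rw [add_mul, mul_comm (f / m)]; omega
    have := Nat.lt_of_mul_lt_mul_right this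
    omega
  · rw [if_neg (by omega)]
    have : (k - 1) * m < (f / m) * m := by
      rw [mul_comm (f / m)]; omega
    have := Nat.lt_of_mul_lt_mul_right this
    omega

theorem card_boundary_le {m s w : ℕ} :
    #{v : Fin m | (v : ℕ) < w ∨ m ≤ v + w ∨ (s ≤ v + w ∧ v ≤ s + w)} ≤ 4 * w + 1 := by
  have h1 : #{v : Fin m | (v : ℕ) < w} ≤ w := by
    rcases Nat.eq_zero_or_pos w with rfl | hw
    · simp
    · refine (card_fin_le_of_mem_Icc _ 0 (w - 1) fun v hv => ?_).trans (by omega)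
      simp at hv ⊢; omega
  have h2 : #{v : Fin m | m ≤ (v : ℕ) + w} ≤ w := by
    rcases Nat.eq_zero_or_pos m with rfl | hm
    · simp
    · refine (card_fin_le_of_mem_Icc _ (m - w) (m - 1) fun v hv => ?_).trans (by omega)
      simp at hv ⊢; omega
  have h3 : #{v : Fin m | s ≤ (v : ℕ) + w ∧ v ≤ s + w} ≤ 2 * w + 1 := by
    refine (card_fin_le_of_mem_Icc _ (s - w) (s + w) fun v hv => ?_).trans (by omega)
    simp at hv ⊢; omega
  rw [Finset.filter_or, Finset.filter_or]
  refine (Finset.card_union_le _ _).trans ?_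
  have := Finset.card_union_le ({v : Fin m | m ≤ (v : ℕ) + w} : Finset _) {v : Fin m | s ≤ (v : ℕ) + w ∧ v ≤ s + w}
  omega

theorem prod_weight_le_of_cluster {x : ℝ} (h0 : 0 < x) (hx : x + x ^ 2 = 1) {m : ℕ} [NeZero m]
    {N K d t : ℕ} (hN : 100 ≤ N) (hK : 4 * d * N ≤ K) (hK0 : 0 < K) (ht : 2 * N + 100 ≤ t)
    {D : Fin K → ℕ} (hD : ∀ j, t * m ≤ D j * N) {E : Finset (Fin m)} {R : Fin m → Finset ℕ}
    (hR : ∀ v ∉ E, ∀ k ∈ R v, k = 0 ∨ ((k - 1) * m + v) * N < (t + 1) * m)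
    {l : Fin m → ℕ} (hl : ∀ v, v ≠ 0 → 1 ≤ l v)
    (hT : ∀ v, #{j | l v + l (reflect m (D j) v) < pairBound m (D j) v} < d) :
    ∏ v, ∑ k ∈ R v with l v ≤ k, x ^ k ≤ Real.exp (-3 * m / N + (4 * #E + 10)) := by
  have hm := NeZero.pos m
  obtain ⟨j, hj⟩ := exists_card_mul_le hK0 _ hT
  rw [Fintype.card_fin] at hj
  set f := D j with hf
  set σ := reflect m f with hσ
  set w := m / N + 1 with hw
  have hwN : m < w * N := by
    rw [hw, mul_comm]; exact Nat.lt_mul_div_succ m (by omega)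
  have hw1 : 1 ≤ w := Nat.le_add_left _ _
  set W : Fin m → ℝ := fun v => ∑ k ∈ R v with l v ≤ k, x ^ k with hW
  have hW0 : ∀ v, 0 ≤ W v := fun v => Finset.sum_nonneg fun _ _ => by positivity
  have hW3 : ∀ v, W v ≤ 3 := fun v => sum_pow_le_three h0 hx _
  set bad : Finset (Fin m) := {v | l v + l (σ v) < pairBound m f v} with hbad
  set bd : Finset (Fin m) :=
    {v : Fin m | (v : ℕ) < w ∨ m ≤ v + w ∨ (f % m ≤ v + w ∧ v ≤ f % m + w)} with hbd
  set X := bad ∪ (E ∪ E.image σ ∪ bd) with hX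
  have hfD : t * m ≤ f * N := hD j
  have hf2 : 2 * m + 100 * m / N ≤ f := by
    have h1 : (2 * m + 100 * m / N) * N ≤ f * N := by
      refine le_trans ?_ ((Nat.mul_le_mul_right m ht).trans hfD)
      have := Nat.div_mul_le_self (100 * m) N
      rw [add_mul]
      nlinarith
    exact Nat.le_of_mul_le_mul_right h1 (by omega)
  have hact := le_card_three_le_pairBound hf2
    (Nat.div_le_of_le_mul (Nat.mul_le_mul_right m hN))
  have hgood : ∀ v ∉ X, W v * W (σ v) ≤ if 3 ≤ pairBound m f v then 4 / 5 else 1 := by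
    intro v hv
    simp only [hX, hbad, hbd, Finset.mem_union, Finset.mem_filter, Finset.mem_univ, true_and,
      Finset.mem_image, not_or, not_lt, not_exists, not_and, not_le] at hv
    obtain ⟨hvb, ⟨hvE, hvE'⟩, hv1, hv2, hv3⟩ := hv
    have hσE : σ v ∉ E := fun h => hvE' _ h (reflect_reflect f v)
    have hside : ((v : ℕ) ≤ f % m ∧ w ≤ (σ v : ℕ) ∧ (σ v : ℕ) ≤ f % m) ∨
        (f % m + w < v ∧ w ≤ (σ v : ℕ) ∧ f % m + w < (σ v : ℕ)) := by
      have := v.isLt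
      rcases le_or_gt (v : ℕ) (f % m) with h | h
      · left; rw [hσ, val_reflect_of_le h]; omega
      · right; rw [hσ, val_reflect_of_lt h]; omega
    have hlev : ∀ u ∉ E, w ≤ (u : ℕ) → ((u : ℕ) ≤ f % m ∨ f % m + w < u) →
        W u ≤ ∑ k ∈ Icc (l u) (pairBound m f u), x ^ k := by
      intro u hu hwu hs
      refine Finset.sum_le_sum_of_subset_of_nonneg (fun k hk => ?_) (fun _ _ _ => by positivity)
      rw [Finset.mem_filter] at hk
      rw [Finset.mem_Icc]
      refine ⟨hk.2, le_pairBound_of_lt ?_ hwu hs⟩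
      refine (hR u hu k hk.1).imp_right fun h => ?_
      have : ((k - 1) * m + u) * N < (f + w) * N := by
        rw [add_mul t, one_mul] at h
        rw [add_mul f]
        omega
      exact Nat.lt_of_mul_lt_mul_right this
    have hne : ∀ u : Fin m, w ≤ (u : ℕ) → 1 ≤ l u := fun u hu => hl u (by
      rintro rfl
      simp at hu)
    have e1 := hlev v hvE hv1 (by tauto)
    have e2 := hlev (σ v) hσE (by tauto) (by tauto)
    rw [hσ, pairBound_reflect, ← hσ] at e2
    have l1 := hne v hv1
    have l2 := hne (σ v) (by tauto)
    have hprod := mul_le_mul e1 e2 (hW0 _) (le_trans (hW0 _) e1)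
    split_ifs with h3
    · exact hprod.trans (pair_weight_le h0 hx h3 l1 l2 hvb)
    · have hp2 : pairBound m f v = 2 := by
        have := two_le_pairBound ((Nat.le_add_right _ _).trans hf2) v
        omega
      rw [hp2] at hprod
      exact hprod.trans (mul_le_one₀ (sum_Icc_two_le h0 hx l1)
        (Finset.sum_nonneg fun _ _ => by positivity) (sum_Icc_two_le h0 hx l2))
  have hpt : ∀ v, W v * W (σ v) ≤ Real.exp ((if v ∈ X then 3.2 else 0) -
      (if 3 ≤ pairBound m f v then 0.2 else 0)) := by
    intro v
    by_cases hv : v ∈ X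
    · have h9 : (9 : ℝ) ≤ Real.exp 3 := by
        have := Real.exp_one_gt_d9
        rw [show (3 : ℝ) = ((3 : ℕ) : ℝ) * 1 by norm_num, Real.exp_nat_mul]
        calc (9 : ℝ) ≤ 2.7 ^ 3 := by norm_num
          _ ≤ _ := by gcongr; linarith
      calc W v * W (σ v) ≤ 3 * 3 := mul_le_mul (hW3 _) (hW3 _) (hW0 _) (by norm_num)
        _ ≤ Real.exp 3 := by linarith
        _ ≤ _ := by
          rw [if_pos hv, Real.exp_le_exp]
          split_ifs <;> norm_num
    · rw [if_neg hv]
      refine (hgood v hv).trans ?_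
      split_ifs
      · have := Real.add_one_le_exp (0 - 0.2 : ℝ)
        linarith
      · simp
  have hsq : (∏ v, W v) ^ 2 ≤ Real.exp (3.2 * #X - 0.2 * #{v | 3 ≤ pairBound m f v}) := by
    calc (∏ v, W v) ^ 2 = ∏ v, W v * W (σ v) := by
          rw [Finset.prod_mul_distrib, (reflect_bijective (m := m) f).prod_comp W, sq]
      _ ≤ ∏ v, Real.exp ((if v ∈ X then 3.2 else 0) -
            (if 3 ≤ pairBound m f v then 0.2 else 0)) :=
          Finset.prod_le_prod (fun v _ => mul_nonneg (hW0 _) (hW0 _)) fun v _ => hpt v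
      _ = _ := by
          rw [← Real.exp_sum, Finset.sum_sub_distrib]
          congr 2
          · simp [mul_comm]
          · rw [← Finset.sum_filter]
            simp [mul_comm]
  have hNr : (0 : ℝ) < N := by exact_mod_cast (by omega : 0 < N)
  have hmN : (0 : ℝ) ≤ (m : ℝ) / N := by positivity
  have hXc : (#X : ℝ) ≤ 4.25 * (m / N) + 2 * #E + 5 := by
    have c1 : (#bad : ℝ) ≤ m / N / 4 := by
      rcases Nat.eq_zero_or_pos d with rfl | hd
      · exact absurd (hT 0) (by omega)
      have : (#bad * (4 * d * N) : ℕ) ≤ d * m := (Nat.mul_le_mul_left _ hK).trans hj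
      have : (#bad * (4 * N)) * d ≤ m * d := by linarith
      have : #bad * (4 * N) ≤ m := Nat.le_of_mul_le_mul_right this hd
      rw [div_div, le_div_iff₀ (by positivity)]
      have h' : ((#bad * (4 * N) : ℕ) : ℝ) ≤ m := by exact_mod_cast this
      push_cast at h'
      linarith
    have c2 : #bd ≤ 4 * w + 1 := card_boundary_le
    have c3 : #(E.image σ) ≤ #E := Finset.card_image_le
    have c4 : #X ≤ #bad + (#E + #E + (4 * w + 1)) := by
      refine (Finset.card_union_le _ _).trans (Nat.add_le_add_left ?_ _)
      refine (Finset.card_union_le _ _).trans (Nat.add_le_add ?_ c2)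
      exact (Finset.card_union_le _ _).trans (Nat.add_le_add_left c3 _)
    have c5 : (w : ℝ) ≤ m / N + 1 := by
      rw [hw]; push_cast
      gcongr
      exact Nat.cast_div_le
    have c6 : (#X : ℝ) ≤ #bad + (#E + #E + (4 * w + 1)) := by exact_mod_cast c4
    linarith
  have hactr : 100 * ((m : ℝ) / N) - 1 ≤ #{v : Fin m | 3 ≤ pairBound m f v} := by
    have h1 : (100 * m : ℕ) < (100 * m / N + 1) * N := by
      rw [mul_comm _ N]; exact Nat.lt_mul_div_succ _ (by omega)
    have h2 : (100 * m : ℝ) < ((100 * m / N : ℕ) + 1) * N := by exact_mod_cast h1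
    rw [← div_lt_iff₀ hNr] at h2
    have h3 : ((100 * m / N : ℕ) : ℝ) ≤ #{v : Fin m | 3 ≤ pairBound m f v} := by
      exact_mod_cast hact
    rw [← mul_div_assoc]
    linarith
  have hP0 : 0 ≤ ∏ v, W v := Finset.prod_nonneg fun v _ => hW0 v
  refine le_of_sq_le_sq (hsq.trans ?_) (Real.exp_pos _).le
  rw [← Real.exp_nat_mul, Real.exp_le_exp]
  rw [mul_div_assoc]
  push_cast
  linarith [(Nat.cast_nonneg #E : (0 : ℝ) ≤ #E)]

theorem sum_prod_le_prod_sum {V : Type*} [Fintype V] [DecidableEq V] (K : Finset (V → ℕ))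
    (F : (V → ℕ) → ℝ) (R : V → Finset ℕ) (g : V → ℕ → ℝ) (hg : ∀ v k, 0 ≤ g v k)
    (hR : ∀ k ∈ K, ∀ v, k v ∈ R v) (hF : ∀ k ∈ K, F k ≤ ∏ v, g v (k v)) :
    ∑ k ∈ K, F k ≤ ∏ v, ∑ a ∈ R v, g v a := by
  rw [Finset.prod_univ_sum]
  refine (Finset.sum_le_sum hF).trans (Finset.sum_le_sum_of_subset_of_nonneg (fun k hk => ?_)
    (fun _ _ _ => Finset.prod_nonneg fun v _ => hg v _))
  exact Fintype.mem_piFinset.2 (hR k hk)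

theorem three_le_exp_two : (3 : ℝ) ≤ Real.exp 2 := by
  have := Real.add_one_le_exp (2 : ℝ)
  linarith

theorem sum_weight_le_of_cluster {x z : ℝ} (h0 : 0 < x) (hx : x + x ^ 2 = 1) (hz : 1 ≤ z)
    {m : ℕ} [NeZero m] {N K d t : ℕ} (hd : z⁻¹ + z⁻¹ ^ d ≤ 1) (hN : 100 ≤ N)
    (hK : 4 * d * N ≤ K) (hK0 : 0 < K) (ht : 2 * N + 100 ≤ t)
    {D : Fin K → ℕ} (hD : ∀ j, t * m ≤ D j * N) (hD' : ∀ j, D j * N < (t + 1) * m)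
    (hDi : Function.Injective D) {E : Finset (Fin m)} (S : Finset (Fin m → ℕ))
    (hQ : ∀ k ∈ S, ∀ v, k v ≤ 21) (h1 : ∀ k ∈ S, ∀ v, v ≠ 0 → 1 ≤ k v)
    (hE : ∀ k ∈ S, ∀ v ∉ E, k v = 0 ∨ ((k v - 1) * m + v) * N < (t + 1) * m)
    (hS : ∀ k ∈ S, ∀ j v, pairBound m (D j) v ≤ k v + k (reflect m (D j) v)) :
    ∑ k ∈ S, ∏ v, x ^ k v ≤ z ^ (22 * m) * Real.exp (-3 * m / N + (4 * #E + 10)) := by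
  have hm := NeZero.pos m
  set R : Fin m → Finset ℕ := fun v =>
    {k ∈ range 22 | v ∈ E ∨ k = 0 ∨ ((k - 1) * m + v) * N < (t + 1) * m} with hR
  have hσ : ∀ v, Function.Injective fun j => reflect m (D j) v := by
    intro v i j hij
    have h2 : D i % m = D j % m := by
      have := sub_left_injective hij
      simpa [Fin.ext_iff] using this
    apply hDi
    have hmN : m ≤ m * N := Nat.le_mul_of_pos_right _ (by omega)
    have key : ∀ i j, D i < D j + m := by
      intro i j
      have a1 := hD' i
      have a2 := hD j
      have : D i * N < (D j + m) * N := by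
        rw [add_mul (D j)]; rw [add_mul t, one_mul] at a1; omega
      exact Nat.lt_of_mul_lt_mul_right this
    have k1 := key i j
    have k2 := key j i
    by_contra hne
    rcases Nat.lt_or_gt_of_ne hne with h | h
    · have := (Nat.modEq_iff_dvd' h.le).1 h2
      exact absurd (Nat.le_of_dvd (by omega) this) (by omega)
    · have := (Nat.modEq_iff_dvd' h.le).1 h2.symm
      exact absurd (Nat.le_of_dvd (by omega) this) (by omega)
  have := sum_prod_le_of_branching h0.le hz (Real.exp_pos (-3 * m / N + (4 * #E + 10))).le hd
    (Q := 21) (R := R) (fun v k hk => by simp [hR] at hk; omega) hσ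
    (fun j v => pairBound m (D j) v) (fun v => if v = 0 then 0 else 1)
    (fun l hl hT => prod_weight_le_of_cluster h0 hx hN hK hK0 ht hD
      (fun v hv k hk => by simpa [hR, hv] using (Finset.mem_filter.1 hk).2)
      (fun v hv => by simpa [hv] using hl v) hT) _ (fun v => le_rfl)
  refine le_trans ?_ (this.trans ?_)
  · refine Finset.sum_le_sum_of_subset_of_nonneg (fun k hk => ?_)
      (fun _ _ _ => Finset.prod_nonneg fun _ _ => by positivity)
    simp only [Finset.mem_filter, Fintype.mem_piFinset, hR, Finset.mem_range]
    refine ⟨fun v => ⟨⟨Nat.lt_succ_of_le (hQ k hk v), ?_⟩, ?_⟩, hS k hk⟩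
    · by_cases hv : v ∈ E
      · exact Or.inl hv
      · exact Or.inr (hE k hk v hv)
    · split_ifs with h
      · exact Nat.zero_le _
      · exact h1 k hk v h
  · gcongr
    refine (Finset.sum_le_card_nsmul univ _ 22 fun v _ => by omega).trans ?_
    simp [mul_comm]

theorem sum_weight_le_of_sparse {x : ℝ} (h0 : 0 < x) (hx : x + x ^ 2 = 1)
    {m : ℕ} [NeZero m] {N f b : ℕ} (hN : 0 < N) (hf : 2 * m + b ≤ f) (hb : b ≤ m)
    {E : Finset (Fin m)} (S : Finset (Fin m → ℕ))
    (h1 : ∀ k ∈ S, ∀ v, v ≠ 0 → 1 ≤ k v)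
    (hE : ∀ k ∈ S, ∀ v ∉ E, k v = 0 ∨ ((k v - 1) * m + v) * N < (2 * N + 100) * m)
    (hS : ∀ k ∈ S, ∀ v, pairBound m f v ≤ k v + k (reflect m f v)) :
    ∑ k ∈ S, ∏ v, x ^ k v ≤ Real.exp (-b / 40 + 2.05 * (#E + (100 * m / N + 1))) := by
  have hm := NeZero.pos m
  obtain ⟨hx1, hx2⟩ := golden_bounds h0 hx
  set σ := reflect m f with hσ
  set w := 100 * m / N + 1 with hw
  have hw1 : 1 ≤ w := Nat.le_add_left _ _
  have hwN : 100 * m < w * N := by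
    rw [hw, mul_comm _ N]; exact Nat.lt_mul_div_succ _ hN
  set B : Finset (Fin m) := E ∪ ({v : Fin m | (v : ℕ) < w} : Finset (Fin m)) with hB
  set V : Finset (Fin m) := {v | 3 ≤ pairBound m f v ∧ v ∉ B ∧ σ v ∉ B} with hV
  have hσσ : ∀ v, σ (σ v) = v := reflect_reflect f
  have hVσ : ∀ v ∈ V, σ v ∈ V := by
    intro v hv
    simp only [hV, Finset.mem_filter, Finset.mem_univ, true_and] at hv ⊢
    rw [hσσ, hσ, pairBound_reflect]
    tauto
  have hBc : #B ≤ #E + w := by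
    refine (Finset.card_union_le _ _).trans (Nat.add_le_add_left ?_ _)
    refine (card_fin_le_of_mem_Icc _ 0 (w - 1) fun v hv => ?_).trans (by omega)
    simp at hv ⊢; omega
  have hVc : b ≤ #V + 2 * (#E + w) := by
    have hsub : ({v : Fin m | 3 ≤ pairBound m f v} : Finset (Fin m)) ⊆ V ∪ (B ∪ B.image σ) := by
      intro v hv
      simp only [Finset.mem_filter, Finset.mem_univ, true_and] at hv
      by_cases h1 : v ∈ B
      · simp [h1]
      by_cases h2 : σ v ∈ B
      · have : v ∈ B.image σ := Finset.mem_image.2 ⟨σ v, h2, hσσ v⟩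
        simp [this]
      · simp [hV, hv, h1, h2]
    have c1 := Finset.card_le_card hsub
    have c2 := Finset.card_union_le V (B ∪ B.image σ)
    have c3 := Finset.card_union_le B (B.image σ)
    have c4 : #(B.image σ) ≤ #B := Finset.card_image_le
    have c5 := le_card_three_le_pairBound hf hb
    omega
  set y := Real.sqrt (x ^ 3) with hy
  have hy0 : 0 ≤ y := Real.sqrt_nonneg _
  have hy2 : y ^ 2 = x ^ 3 := Real.sq_sqrt (by positivity)
  have hlow : ∀ k ∈ S, ∀ v ∉ B, 1 ≤ k v ∧ k v ≤ 2 := by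
    intro k hk v hv
    simp only [hB, Finset.mem_union, Finset.mem_filter, Finset.mem_univ, true_and, not_or,
      not_lt] at hv
    have hv1 : 1 ≤ k v := h1 k hk v (by
      rintro rfl
      simp [hw] at hv)
    refine ⟨hv1, ?_⟩
    rcases hE k hk v hv.1 with h | h
    · omega
    have h2 : w * N ≤ v * N := Nat.mul_le_mul_right _ hv.2
    have h3 : (k v - 1) * (m * N) < 2 * (m * N) := by
      rw [add_mul] at h
      nlinarith
    have := Nat.lt_of_mul_lt_mul_right h3
    omega
  have hbound := sum_prod_le_prod_sum S (fun k => ∏ v, x ^ k v)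
    (fun v => S.image fun k => k v) (fun v a => if v ∈ V then y else x ^ a)
    (fun v k => by split_ifs <;> positivity) (fun k hk v => Finset.mem_image_of_mem _ hk) (by
      intro k hk
      rw [← Finset.prod_filter_mul_prod_filter_not univ (· ∈ V) (fun v => x ^ k v),
        ← Finset.prod_filter_mul_prod_filter_not univ (· ∈ V)
          (fun v => if v ∈ V then y else x ^ k v)]
      refine mul_le_mul ?_ (le_of_eq ?_) (Finset.prod_nonneg fun _ _ => by positivity)
        (Finset.prod_nonneg fun _ _ => by split_ifs <;> positivity)
      · have e : ({v | v ∈ V} : Finset (Fin m)) = V := by ext; simp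
        rw [e]
        refine le_of_sq_le_sq ?_ (Finset.prod_nonneg fun _ _ => by split_ifs; all_goals positivity)
        have e2 : ∏ v ∈ V, x ^ k v = ∏ v ∈ V, x ^ k (σ v) :=
          Finset.prod_nbij' σ σ hVσ hVσ (fun v _ => hσσ v) (fun v _ => hσσ v)
            (fun v _ => by rw [hσσ])
        rw [sq]
        nth_rewrite 2 [e2]
        rw [← Finset.prod_mul_distrib, ← Finset.prod_pow]
        refine Finset.prod_le_prod (fun _ _ => by positivity) fun v hv => ?_
        rw [if_pos hv, hy2, ← pow_add]
        refine pow_le_pow_of_le_one h0.le (by linarith) (le_trans ?_ (hS k hk v))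
        simp only [hV, Finset.mem_filter, Finset.mem_univ, true_and] at hv
        exact hv.1
      · refine Finset.prod_congr rfl fun v hv => ?_
        simp only [Finset.mem_filter, Finset.mem_univ, true_and] at hv
        rw [if_neg hv])
  refine hbound.trans ?_
  have himg : ∀ v ∉ B, S.image (fun k => k v) ⊆ Icc 1 2 := by
    intro v hv a ha
    obtain ⟨k, hk, rfl⟩ := Finset.mem_image.1 ha
    exact Finset.mem_Icc.2 (hlow k hk v hv)
  have hpt : ∀ v, ∑ a ∈ S.image (fun k => k v), (if v ∈ V then y else x ^ a) ≤
      Real.exp ((if v ∈ B then 2 else 0) - if v ∈ V then 1 / 40 else 0) := by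
    intro v
    by_cases hv : v ∈ V
    · have hvB : v ∉ B := by
        simp only [hV, Finset.mem_filter, Finset.mem_univ, true_and] at hv
        exact hv.2.1
      simp only [if_pos hv, if_neg hvB, Finset.sum_const, nsmul_eq_mul]
      have hc : #(S.image fun k => k v) ≤ 2 := by
        simpa using Finset.card_le_card (himg v hvB)
      have hc' : (#(S.image fun k => k v) : ℝ) ≤ 2 := by exact_mod_cast hc
      refine (mul_le_mul_of_nonneg_right hc' hy0).trans ?_
      refine le_of_sq_le_sq ?_ (Real.exp_pos _).le
      rw [← Real.exp_nat_mul, mul_pow, hy2]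
      refine le_trans ?_ (Real.add_one_le_exp _)
      have e3 : x ^ 3 = 2 * x - 1 := by linear_combination (x - 1) * hx
      rw [e3]
      norm_num
      linarith
    · simp only [if_neg hv, sub_zero]
      by_cases hvB : v ∈ B
      · rw [if_pos hvB]
        exact (sum_pow_le_three h0 hx _).trans three_le_exp_two
      · rw [if_neg hvB, Real.exp_zero]
        refine le_trans (Finset.sum_le_sum_of_subset_of_nonneg (himg v hvB)
          fun _ _ _ => by positivity) (sum_Icc_two_le h0 hx le_rfl)
  refine (Finset.prod_le_prod (fun v _ => Finset.sum_nonneg fun _ _ => by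
    split_ifs <;> positivity) fun v _ => hpt v).trans ?_
  rw [← Real.exp_sum, Real.exp_le_exp, Finset.sum_sub_distrib]
  have s1 : (∑ v, if v ∈ B then (2 : ℝ) else 0) = 2 * #B := by simp [mul_comm]
  have s2 : (∑ v, if v ∈ V then (1 / 40 : ℝ) else 0) = #V / 40 := by
    simp [div_eq_mul_inv]
  rw [s1, s2]
  have r1 : (#B : ℝ) ≤ #E + w := by exact_mod_cast hBc
  have r2 : (b : ℝ) ≤ #V + 2 * (#E + w) := by exact_mod_cast hVc
  have r3 : (w : ℝ) ≤ 100 * m / N + 1 := by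
    rw [hw]; push_cast
    gcongr
    exact Nat.cast_div_le.trans (by push_cast; rfl)
  linarith

theorem sum_weight_le_of_large {x : ℝ} (h0 : 0 < x) (hx : x + x ^ 2 = 1)
    {m : ℕ} [NeZero m] (S : Finset (Fin m → ℕ))
    (hS : ∀ k ∈ S, ∃ f, 21 * m ≤ f ∧ ∀ v, pairBound m f v ≤ k v + k (reflect m f v)) :
    ∑ k ∈ S, ∏ v, x ^ k v ≤ (3 / 5) ^ m := by
  obtain ⟨hx1, hx2⟩ := golden_bounds h0 hx
  have hr1 : x / (3 / 4) ≤ 0.8242 := by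
    rw [div_le_iff₀ (by norm_num)]; linarith
  have hsum : ∀ k ∈ S, 10 * m ≤ ∑ v, k v := by
    intro k hk
    obtain ⟨f, hf, h⟩ := hS k hk
    have h1 : ∑ _v : Fin m, 21 ≤ ∑ v, (k v + k (reflect m f v)) := by
      refine Finset.sum_le_sum fun v _ => le_trans ?_ (h v)
      exact le_trans ((Nat.le_div_iff_mul_le (NeZero.pos m)).2 hf) (Nat.le_add_right _ _)
    rw [Finset.sum_add_distrib, (reflect_bijective (m := m) f).sum_comp k] at h1
    simp at h1
    omega
  calc ∑ k ∈ S, ∏ v, x ^ k v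
      ≤ ∑ k ∈ S, (x / (3 / 4)) ^ (10 * m) * ∏ v, (3 / 4 : ℝ) ^ k v := by
        refine Finset.sum_le_sum fun k hk => ?_
        rw [Finset.prod_pow_eq_pow_sum, Finset.prod_pow_eq_pow_sum]
        calc x ^ ∑ v, k v = (x / (3 / 4)) ^ (∑ v, k v) * (3 / 4) ^ (∑ v, k v) := by
              rw [← mul_pow]; congr 1; ring
          _ ≤ _ := by
              refine mul_le_mul_of_nonneg_right ?_ (by positivity)
              exact pow_le_pow_of_le_one (by positivity) (by linarith) (hsum k hk)
    _ = (x / (3 / 4)) ^ (10 * m) * ∑ k ∈ S, ∏ v, (3 / 4 : ℝ) ^ k v := by rw [Finset.mul_sum]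
    _ ≤ (x / (3 / 4)) ^ (10 * m) * ∏ v : Fin m, ∑ a ∈ S.image (fun k => k v), (3 / 4 : ℝ) ^ a := by
        gcongr
        exact sum_prod_le_prod_sum S _ _ (fun _ a => (3 / 4 : ℝ) ^ a) (fun _ _ => by positivity)
          (fun k hk v => Finset.mem_image_of_mem _ hk) (fun _ _ => le_rfl)
    _ ≤ (x / (3 / 4)) ^ (10 * m) * ∏ _v : Fin m, 4 := by
        gcongr with v
        refine (sum_pow_le_inv (by norm_num) (by norm_num) _).trans (by norm_num)
    _ = ((x / (3 / 4)) ^ 10 * 4) ^ m := by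
        rw [mul_pow, ← pow_mul]; simp
    _ ≤ (3 / 5) ^ m := by
        gcongr
        calc (x / (3 / 4)) ^ 10 * 4 ≤ 0.8242 ^ 10 * 4 := by gcongr
          _ ≤ 3 / 5 := by norm_num

theorem sum_weight_le_of_small {x : ℝ} (h0 : 0 < x) (hx : x + x ^ 2 = 1)
    {m : ℕ} [NeZero m] {b : ℕ} (hb : b ≤ m) (S : Finset (Fin m → ℕ))
    (h1 : ∀ k ∈ S, ∀ v, v ≠ 0 → 1 ≤ k v)
    (hS : ∀ k ∈ S, ∀ v, k v = 0 ∨ (k v - 1) * m + v + b ≤ 2 * m) :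
    ∑ k ∈ S, ∏ v, x ^ k v ≤ Real.exp (-0.3 * b + 2.3) := by
  have hm := NeZero.pos m
  obtain ⟨hx1, hx2⟩ := golden_bounds h0 hx
  refine (sum_prod_le_prod_sum S _ (fun v => S.image fun k => k v) (fun _ a => x ^ a)
    (fun _ _ => by positivity) (fun k hk v => Finset.mem_image_of_mem _ hk)
    (fun _ _ => le_rfl)).trans ?_
  have hpt : ∀ v, ∑ a ∈ S.image (fun k => k v), x ^ a ≤
      Real.exp ((if v = 0 then 2 else 0) - if m < v + b then 0.3 else 0) := by
    intro v
    by_cases hv : v = 0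
    · subst hv
      rw [if_pos rfl, if_neg (by simpa using hb), sub_zero]
      exact (sum_pow_le_three h0 hx _).trans three_le_exp_two
    have hv0 : 0 < (v : ℕ) := Nat.pos_of_ne_zero fun h => hv (Fin.ext h)
    rw [if_neg hv]
    split_ifs with hvb
    · have : S.image (fun k => k v) ⊆ {1} := by
        intro a ha
        obtain ⟨k, hk, rfl⟩ := Finset.mem_image.1 ha
        have hk1 := h1 k hk v hv
        have h2 := (hS k hk v).resolve_left (by omega)
        have : (k v - 1) * m < 1 * m := by omega
        have := Nat.lt_of_mul_lt_mul_right this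
        simp only [Finset.mem_singleton]
        omega
      refine (Finset.sum_le_sum_of_subset_of_nonneg this fun _ _ _ => by positivity).trans ?_
      have := Real.add_one_le_exp (0 - 0.3 : ℝ)
      simp only [Finset.sum_singleton, pow_one]
      linarith
    · have : S.image (fun k => k v) ⊆ Icc 1 2 := by
        intro a ha
        obtain ⟨k, hk, rfl⟩ := Finset.mem_image.1 ha
        have hk1 := h1 k hk v hv
        have h2 := (hS k hk v).resolve_left (by omega)
        have : (k v - 1) * m < 2 * m := by omega
        have := Nat.lt_of_mul_lt_mul_right this
        rw [Finset.mem_Icc]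
        omega
      rw [sub_zero, Real.exp_zero]
      exact (Finset.sum_le_sum_of_subset_of_nonneg this fun _ _ _ => by positivity).trans
        (sum_Icc_two_le h0 hx le_rfl)
  refine (Finset.prod_le_prod (fun v _ => Finset.sum_nonneg fun _ _ => by positivity)
    fun v _ => hpt v).trans ?_
  rw [← Real.exp_sum, Real.exp_le_exp, Finset.sum_sub_distrib, ← Finset.sum_filter,
    ← Finset.sum_filter]
  have hc : b ≤ #{v : Fin m | m < v + b} + 1 := by
    have : #(range (b - 1)) ≤ #{v : Fin m | m < v + b} := by
      refine Finset.card_le_card_of_injOn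
        (fun i => ⟨m - 1 - i, by omega⟩) (fun i hi => ?_) (fun i hi j hj h => ?_)
      · simp at hi ⊢; omega
      · simp at hi hj h; omega
    rw [Finset.card_range] at this
    omega
  have hc' : (b : ℝ) ≤ #{v : Fin m | m < v + b} + 1 := by exact_mod_cast hc
  simp only [Finset.sum_const, nsmul_eq_mul, Finset.filter_eq', Finset.mem_univ, if_true,
    Finset.card_singleton]
  push_cast
  linarith

/-- `g` is a gap of the semigroup of multiplicity `m` with Kunz coordinates `k`. -/
def IsGap {m : ℕ} [NeZero m] (k : Fin m → ℕ) (g : ℕ) : Prop := g / m < k (Fin.ofNat m g)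

/-- The properties of the Kunz coordinates of a numerical semigroup of multiplicity `m`
that are used in the weighted counting. -/
structure IsAdmissible {m : ℕ} [NeZero m] (k : Fin m → ℕ) : Prop where
  pos : ∀ v, v ≠ 0 → 1 ≤ k v
  pair : ∀ f, IsGap k f → ∀ v, pairBound m f v ≤ k v + k (reflect m f v)

theorem exists_greatest {P : ℕ → Prop} {B : ℕ} (hB : ∀ t, P t → t ≤ B) (h : ∃ t, P t) :
    ∃ t, P t ∧ ∀ s, P s → s ≤ t :=
  ⟨sSup {t | P t}, Nat.sSup_mem h ⟨B, hB⟩, fun s hs => le_csSup (a := s) ⟨B, hB⟩ hs⟩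

section Gaps

variable {m : ℕ} [NeZero m] {k : Fin m → ℕ}

theorem ofNat_mul_add (a : ℕ) (v : Fin m) : Fin.ofNat m (a * m + v) = v := by
  ext
  simp [Nat.mod_eq_of_lt v.isLt]

theorem isGap_top {v : Fin m} (hv : k v ≠ 0) : IsGap k ((k v - 1) * m + v) := by
  rw [IsGap, ofNat_mul_add, mul_comm, Nat.mul_add_div (NeZero.pos m), Nat.div_eq_of_lt v.isLt]
  omega

theorem le_of_isGap_lt {Q : ℕ} (h : ∀ g, IsGap k g → g < Q * m) (v : Fin m) : k v ≤ Q := by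
  by_cases hv : k v = 0
  · omega
  have := h _ (isGap_top hv)
  have : (k v - 1) * m < Q * m := by omega
  have := Nat.lt_of_mul_lt_mul_right this
  omega

theorem exists_range_superset (E : Finset (Fin m)) {n : ℕ} (h : #E ≤ n) :
    ∃ e : Fin n → Fin m, E ⊆ univ.image e := by
  refine ⟨fun i => if hi : (i : ℕ) < #E then (E.equivFin.symm ⟨i, hi⟩ : Fin m) else 0, ?_⟩
  intro v hv
  refine Finset.mem_image.2 ⟨⟨E.equivFin ⟨v, hv⟩, (E.equivFin ⟨v, hv⟩).isLt.trans_le h⟩,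
    Finset.mem_univ _, ?_⟩
  simp

/-- If few gaps lie in each window above `t₁ m / N`, then outside few residues all gaps lie
below `t₁ m / N`. -/
theorem exists_exceptional {N K t₁ : ℕ} (hN : 0 < N) (hgap : ∀ g, IsGap k g → g < 21 * m)
    (G : Finset ℕ) (hG : ∀ g, g ∈ G ↔ IsGap k g)
    (h : ∀ t, t₁ ≤ t → t < 21 * N → #{g ∈ G | g * N / m = t} ≤ K) :
    ∃ e : Fin (K * (21 * N)) → Fin m, ∀ v ∉ univ.image e,
      k v = 0 ∨ ((k v - 1) * m + v) * N < t₁ * m := by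
  have hm := NeZero.pos m
  set H : Finset ℕ := {g ∈ G | t₁ ≤ g * N / m} with hH
  have hHc : #H ≤ K * (21 * N) := by
    rw [← Finset.card_range (21 * N)]
    have hlt : ∀ g ∈ H, g * N / m < 21 * N := by
      intro g hg
      have hg := hgap g ((hG g).1 (Finset.mem_filter.1 hg).1)
      rw [Nat.div_lt_iff_lt_mul hm]
      calc g * N < 21 * m * N := Nat.mul_lt_mul_of_pos_right hg hN
        _ = 21 * N * m := by ring
    refine Finset.card_le_mul_card_image_of_maps_to (f := fun g => g * N / m)
      (fun g hg => Finset.mem_range.2 (hlt g hg)) K fun t ht => ?_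
    rw [Finset.mem_range] at ht
    by_cases htt : t₁ ≤ t
    · refine le_trans (Finset.card_le_card ?_) (h t htt ht)
      intro g hg
      simp only [hH, Finset.mem_filter] at hg ⊢
      exact ⟨hg.1.1, hg.2⟩
    · rw [Finset.card_eq_zero.2]
      · exact Nat.zero_le _
      · refine Finset.filter_eq_empty_iff.2 fun g hg hgt => ?_
        simp only [hH, Finset.mem_filter] at hg
        omega
  obtain ⟨e, he⟩ := exists_range_superset (H.image (Fin.ofNat m))
    (Finset.card_image_le.trans hHc)
  refine ⟨e, fun v hv => ?_⟩
  by_contra! hc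
  refine hv (he (Finset.mem_image.2 ⟨(k v - 1) * m + v, ?_, ofNat_mul_add _ _⟩))
  rw [hH, Finset.mem_filter, hG]
  exact ⟨isGap_top hc.1, (Nat.le_div_iff_mul_le hm).2 hc.2⟩

end Gaps

open Classical in
theorem sum_weight_le_of_middle {x z : ℝ} (h0 : 0 < x) (hx : x + x ^ 2 = 1) (hz : 1 ≤ z)
    {m : ℕ} [NeZero m] {N K d b : ℕ} (hd : z⁻¹ + z⁻¹ ^ d ≤ 1) (hN : 100 ≤ N)
    (hK : 4 * d * N ≤ K) (hK0 : 0 < K) (hb : b ≤ m) (S : Finset (Fin m → ℕ))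
    (hS : ∀ k ∈ S, IsAdmissible k) (hgap : ∀ k ∈ S, ∀ g, IsGap k g → g < 21 * m)
    (hf : ∀ k ∈ S, ∃ f, IsGap k f ∧ 2 * m + b ≤ f) :
    ∑ k ∈ S, ∏ v, x ^ k v ≤
      (21 * m) * m ^ (K * (21 * N)) *
        Real.exp (-b / 40 + 2.05 * (↑(K * (21 * N)) + (100 * m / N + 1))) +
      (21 * N) * ((21 * m) ^ K * m ^ (K * (21 * N))) *
        (z ^ (22 * m) * Real.exp (-3 * m / N + (4 * ↑(K * (21 * N)) + 10))) := by
  have hm := NeZero.pos m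
  have hN0 : 0 < N := by omega
  set n := K * (21 * N) with hn
  have hw : ∀ k : Fin m → ℕ, 0 ≤ ∏ v, x ^ k v := fun k =>
    Finset.prod_nonneg fun _ _ => by positivity
  have hcard : ∀ e : Fin n → Fin m, (#(univ.image e) : ℝ) ≤ n := by
    intro e
    have : #(univ.image e) ≤ n := Finset.card_image_le.trans (by simp)
    exact_mod_cast this
  let P : (Fin m → ℕ) → Prop := fun k => ∃ t, 2 * N + 100 ≤ t ∧ t < 21 * N ∧
    K ≤ #{g ∈ {g ∈ range (21 * m) | IsGap k g} | g * N / m = t}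
  have hGmem : ∀ k ∈ S, ∀ g, g ∈ ({g ∈ range (21 * m) | IsGap k g} : Finset ℕ) ↔ IsGap k g := by
    intro k hk g
    simp only [Finset.mem_filter, Finset.mem_range, and_iff_right_iff_imp]
    exact hgap k hk g
  rw [← Finset.sum_filter_not_add_sum_filter S P]
  refine add_le_add ?_ ?_
  · refine (sum_le_sum_sum_filter _ (univ : Finset (Fin (21 * m) × (Fin n → Fin m)))
      (fun p k => IsGap k p.1 ∧ 2 * m + b ≤ p.1 ∧ ∀ v ∉ univ.image p.2,
        k v = 0 ∨ ((k v - 1) * m + v) * N < (2 * N + 100) * m) _ (fun k _ => hw k) ?_).trans ?_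
    · intro k hk
      rw [Finset.mem_filter] at hk
      obtain ⟨hk, hkP⟩ := hk
      obtain ⟨f, hf1, hf2⟩ := hf k hk
      obtain ⟨e, he⟩ := exists_exceptional (K := K) (t₁ := 2 * N + 100) hN0 (hgap k hk) _
        (hGmem k hk) (fun t ht1 ht2 => by
          by_contra! hc
          exact hkP ⟨t, ht1, ht2, hc.le⟩)
      exact ⟨(⟨f, hgap k hk f hf1⟩, e), Finset.mem_univ _, hf1, hf2, he⟩
    · refine (Finset.sum_le_card_nsmul _ _
        (Real.exp (-b / 40 + 2.05 * (n + (100 * m / N + 1)))) ?_).trans ?_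
      · rintro ⟨f, e⟩ -
        rcases Finset.eq_empty_or_nonempty ({k ∈ {k ∈ S | ¬ P k} | IsGap k f ∧ 2 * m + b ≤ f ∧
          ∀ v ∉ univ.image e, k v = 0 ∨ ((k v - 1) * m + v) * N < (2 * N + 100) * m} :
            Finset (Fin m → ℕ)) with h | ⟨k₀, hk₀⟩
        · simp only [h, Finset.sum_empty]
          positivity
        · have hf2 := (Finset.mem_filter.1 hk₀).2.2.1
          refine (sum_weight_le_of_sparse h0 hx hN0 hf2 hb (E := univ.image e) _
            (fun k hk => ?_) (fun k hk => ?_) (fun k hk => ?_)).trans ?_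
          · simp only [Finset.mem_filter] at hk
            exact (hS k hk.1.1).pos
          · simp only [Finset.mem_filter] at hk
            exact hk.2.2.2
          · simp only [Finset.mem_filter] at hk
            exact (hS k hk.1.1).pair _ hk.2.1
          · have := hcard e
            gcongr
      · simp
  · refine (sum_le_sum_sum_filter _
      (univ : Finset (Fin (21 * N) × (Fin K → Fin (21 * m)) × (Fin n → Fin m)))
      (fun p k => 2 * N + 100 ≤ p.1 ∧ (∀ j, p.1 * m ≤ p.2.1 j * N) ∧
        (∀ j, p.2.1 j * N < (p.1 + 1) * m) ∧ Function.Injective p.2.1 ∧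
        (∀ j, IsGap k (p.2.1 j)) ∧ ∀ v ∉ univ.image p.2.2,
        k v = 0 ∨ ((k v - 1) * m + v) * N < (p.1 + 1) * m) _ (fun k _ => hw k) ?_).trans ?_
    · intro k hk
      rw [Finset.mem_filter] at hk
      obtain ⟨hk, hkP⟩ := hk
      obtain ⟨t, ht, hmax⟩ := exists_greatest (fun t ht => ht.2.1.le) hkP
      obtain ⟨ht1, ht2, ht3⟩ := ht
      obtain ⟨e, he⟩ := exists_exceptional (K := K) (t₁ := t + 1) hN0 (hgap k hk) _
        (hGmem k hk) (fun t' ht1' ht2' => by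
          by_contra! hc
          have := hmax t' ⟨by omega, ht2', hc.le⟩
          omega)
      obtain ⟨D, hD⟩ : ∃ D : Fin K → ℕ, Function.Injective D ∧
          ∀ j, IsGap k (D j) ∧ D j * N / m = t := by
        obtain ⟨H, hH, hHc⟩ := Finset.exists_subset_card_eq ht3
        refine ⟨fun j => H.equivFinOfCardEq hHc |>.symm j, ?_, fun j => ?_⟩
        · exact Subtype.val_injective.comp (Equiv.injective _)
        · have := hH ((H.equivFinOfCardEq hHc).symm j).2
          simp only [Finset.mem_filter] at this
          exact ⟨this.1.2, this.2⟩
      refine ⟨(⟨t, ht2⟩, fun j => ⟨D j, hgap k hk _ (hD.2 j).1⟩, e), Finset.mem_univ _, ht1,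
        fun j => ?_, fun j => ?_, fun i j hij => hD.1 (by simpa using hij),
        fun j => (hD.2 j).1, he⟩
      · exact (Nat.le_div_iff_mul_le hm).1 (hD.2 j).2.ge
      · exact (Nat.div_lt_iff_lt_mul hm).1 (by rw [(hD.2 j).2]; exact Nat.lt_succ_self t)
    · refine (Finset.sum_le_card_nsmul _ _
        (z ^ (22 * m) * Real.exp (-3 * m / N + (4 * n + 10))) ?_).trans ?_
      · rintro ⟨t, D, e⟩ -
        set T : Finset (Fin m → ℕ) := _
        change ∑ k ∈ T, ∏ v, x ^ k v ≤ _
        rcases Finset.eq_empty_or_nonempty T with h | ⟨k₀, hk₀⟩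
        · simp only [h, Finset.sum_empty]
          positivity
        · obtain ⟨ht, hD1, hD2, hDi, -⟩ := (Finset.mem_filter.1 hk₀).2
          have hT : ∀ k ∈ T, k ∈ S := fun k hk =>
            (Finset.mem_filter.1 (Finset.mem_filter.1 hk).1).1
          refine (sum_weight_le_of_cluster h0 hx hz hd hN hK hK0 ht hD1 hD2
            (fun i j hij => hDi (Fin.ext hij)) (E := univ.image e) T
            (fun k hk => le_of_isGap_lt (hgap k (hT k hk)))
            (fun k hk => (hS k (hT k hk)).pos)
            (fun k hk => (Finset.mem_filter.1 hk).2.2.2.2.2.2)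
            (fun k hk j => (hS k (hT k hk)).pair _
              ((Finset.mem_filter.1 hk).2.2.2.2.2.1 j))).trans ?_
          have := hcard e
          gcongr
      · simp

open Classical in
/-- The total weight of the Kunz coordinate vectors of multiplicity `m` whose largest gap is far
from `2m` is bounded by a summable function of `m`. -/
theorem exists_summable_bound {x : ℝ} (h0 : 0 < x) (hx : x + x ^ 2 = 1) {ε : ℝ} (hε : 0 < ε)
    (hε1 : ε ≤ 1) :
    ∃ B : ℕ → ℝ, Summable B ∧ (∀ m, 0 ≤ B m) ∧ ∀ (m : ℕ) [NeZero m] (S : Finset (Fin m → ℕ)),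
      (∀ k ∈ S, IsAdmissible k) →
      (∀ k ∈ S, (∃ f, IsGap k f ∧ (2 + ε) * m ≤ f) ∨ ∀ f, IsGap k f → (f : ℝ) ≤ (2 - ε) * m) →
      ∑ k ∈ S, ∏ v, x ^ k v ≤ B m := by
  obtain ⟨N, hN⟩ := exists_nat_ge (16400 / ε)
  have hNε : 16400 ≤ N * ε := (div_le_iff₀ hε).1 hN
  have hN100 : 100 ≤ N := by
    have : (100 : ℝ) ≤ N := by nlinarith [(Nat.cast_nonneg N : (0 : ℝ) ≤ N)]
    exact_mod_cast this
  have hN0 : (0 : ℝ) < N := by exact_mod_cast (by omega : 0 < N)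
  set z : ℝ := 1 + 1 / (22 * N) with hz
  have hz1 : 1 < z := by rw [hz]; linarith [show 0 < 1 / (22 * (N : ℝ)) by positivity]
  have hzinv : z⁻¹ < 1 := inv_lt_one_of_one_lt₀ hz1
  obtain ⟨d, hd⟩ := exists_pow_lt_of_lt_one (sub_pos.2 hzinv) hzinv
  set K := 4 * d * N + 1 with hK
  set n := K * (21 * N) with hn
  have hzexp : ∀ m : ℕ, z ^ (22 * m) ≤ Real.exp (m / N) := by
    intro m
    calc z ^ (22 * m) ≤ Real.exp (1 / (22 * N)) ^ (22 * m) := by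
          gcongr
          rw [hz, add_comm]
          exact Real.add_one_le_exp _
      _ = Real.exp (m / N) := by
          rw [← Real.exp_nat_mul]
          congr 1
          push_cast
          field_simp
  refine ⟨fun m => (3 / 5) ^ m + Real.exp 2.6 * (m ^ 0 * Real.exp (-(0.3 * ε) * m)) +
    (21 * Real.exp (2.05 * n + 2.1) * (m ^ (n + 1) * Real.exp (-(ε / 80) * m)) +
    21 * N * 21 ^ K * Real.exp (4 * n + 10) * (m ^ (K + n) * Real.exp (-(2 / N) * m))),
    ?_, fun m => by positivity, ?_⟩
  · refine ((summable_geometric_of_lt_one (by norm_num) (by norm_num)).add ?_).add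
      (Summable.add ?_ ?_)
    all_goals
      exact (Real.summable_pow_mul_exp_neg_nat_mul _ (by positivity)).mul_left _
  intro m _ S hS hbad
  have hm : (0 : ℝ) < m := by exact_mod_cast NeZero.pos m
  set b := ⌊ε * m⌋₊ with hb
  have hbε : (b : ℝ) ≤ ε * m := Nat.floor_le (by positivity)
  have hbε' : ε * m < b + 1 := Nat.lt_floor_add_one _
  have hbm : b ≤ m := by
    have : (b : ℝ) ≤ m := hbε.trans (by nlinarith)
    exact_mod_cast this
  rw [← Finset.sum_filter_add_sum_filter_not S (fun k => ∃ f, IsGap k f ∧ 21 * m ≤ f),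
    ← Finset.sum_filter_add_sum_filter_not {k ∈ S | ¬ ∃ f, IsGap k f ∧ 21 * m ≤ f}
      (fun k => ∃ f, IsGap k f ∧ (2 + ε) * m ≤ f), add_comm (∑ k ∈ _ with _, _) (∑ k ∈ _ with _, _),
    ← add_assoc]
  refine add_le_add (add_le_add ?_ ?_) ?_
  · refine sum_weight_le_of_large h0 hx _ fun k hk => ?_
    obtain ⟨hk, f, hf, hfm⟩ := Finset.mem_filter.1 hk
    exact ⟨f, hfm, (hS k hk).pair f hf⟩
  · refine (sum_weight_le_of_small h0 hx hbm _ (fun k hk => ?_) (fun k hk v => ?_)).trans ?_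
    · simp only [Finset.mem_filter] at hk
      exact (hS k hk.1.1).pos
    · simp only [Finset.mem_filter] at hk
      rcases Nat.eq_zero_or_pos (k v) with hv | hv
      · exact Or.inl hv
      right
      have := (hbad k hk.1.1).resolve_left hk.2 _ (isGap_top hv.ne')
      have : (((k v - 1) * m + v + b : ℕ) : ℝ) ≤ (2 * m : ℕ) := by
        push_cast at this ⊢
        linarith
      exact_mod_cast this
    · rw [pow_zero, one_mul, ← Real.exp_add, Real.exp_le_exp]
      linarith
  · refine (sum_weight_le_of_middle h0 hx hz1.le (by linarith : z⁻¹ + z⁻¹ ^ d ≤ 1) hN100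
      (by omega : 4 * d * N ≤ K) (by omega) hbm _ (fun k hk => ?_) (fun k hk g hg => ?_)
      (fun k hk => ?_)).trans (add_le_add ?_ ?_)
    · simp only [Finset.mem_filter] at hk
      exact hS k hk.1.1
    · simp only [Finset.mem_filter] at hk
      by_contra! hc
      exact hk.1.2 ⟨g, hg, hc⟩
    · simp only [Finset.mem_filter] at hk
      obtain ⟨f, hf, hfm⟩ := hk.2
      refine ⟨f, hf, ?_⟩
      have : ((2 * m + b : ℕ) : ℝ) ≤ f := by
        push_cast
        linarith
      exact_mod_cast this
    · have hle : 100 * (m : ℝ) / N ≤ ε * m / 164 := by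
        rw [div_le_div_iff₀ hN0 (by norm_num)]
        nlinarith
      calc (21 * m) * (m : ℝ) ^ n * Real.exp (-b / 40 + 2.05 * (n + (100 * m / N + 1)))
          ≤ (21 * m) * (m : ℝ) ^ n * Real.exp ((2.05 * n + 2.1) + -(ε / 80) * m) := by
            refine mul_le_mul_of_nonneg_left (Real.exp_le_exp.2 ?_) (by positivity)
            linarith
        _ = _ := by
            rw [Real.exp_add]
            ring
    · calc (21 * N) * ((21 * (m : ℝ)) ^ K * m ^ n) *
            (z ^ (22 * m) * Real.exp (-3 * m / N + (4 * n + 10)))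
          ≤ (21 * N) * ((21 * (m : ℝ)) ^ K * m ^ n) *
            (Real.exp (m / N) * Real.exp (-3 * m / N + (4 * n + 10))) := by
            gcongr
            exact hzexp m
        _ = _ := by
            rw [← Real.exp_add, show (m : ℝ) / N + (-3 * m / N + (4 * n + 10)) =
              (4 * n + 10) + -(2 / N) * m by ring, Real.exp_add]
            ring

end Kunz

namespace NumericalSemigroup

open Finset

variable (S : NumericalSemigroup)

theorem ext_carrier {S T : NumericalSemigroup} (h : ∀ n, n ∈ S.carrier ↔ n ∈ T.carrier) :
    S = T := by
  have h' : S.carrier = T.carrier := Set.ext h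
  cases S
  cases T
  cases h'
  rfl

theorem mul_mem {m : ℕ} (hm : m ∈ S.carrier) (a : ℕ) : a * m ∈ S.carrier := by
  induction a with
  | zero => simpa using S.zero_mem
  | succ a ih => simpa [add_mul] using S.add_mem ih hm

theorem mem_of_modEq {m s n : ℕ} (hm : m ∈ S.carrier) (hs : s ∈ S.carrier) (hsn : s ≤ n)
    (h : s % m = n % m) : n ∈ S.carrier := by
  obtain ⟨c, hc⟩ := (Nat.modEq_iff_dvd' hsn).1 h
  have := S.add_mem hs (S.mul_mem hm c)
  rwa [mul_comm, ← hc, Nat.add_sub_cancel' hsn] at this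

theorem exists_bound : ∃ n₀, ∀ n, n₀ ≤ n → n ∈ S.carrier := by
  obtain ⟨n₀, h⟩ := S.cofinite.bddAbove
  refine ⟨n₀ + 1, fun n hn => ?_⟩
  by_contra hc
  have := h hc
  omega

theorem multiplicity_mem : S.multiplicity ∈ S.carrier ∧ S.multiplicity ≠ 0 := by
  obtain ⟨n₀, h⟩ := S.exists_bound
  exact Nat.sInf_mem (s := {n : ℕ | n ∈ S.carrier ∧ n ≠ 0}) ⟨n₀ + 1, h _ (by omega), by omega⟩

theorem multiplicity_le {n : ℕ} (hn : n ∈ S.carrier) (h0 : n ≠ 0) : S.multiplicity ≤ n :=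
  Nat.sInf_le ⟨hn, h0⟩

theorem le_frobenius {n : ℕ} (hn : n ∉ S.carrier) : n ≤ S.frobenius :=
  le_csSup S.cofinite.bddAbove hn

theorem frobenius_notMem (h : S.frobenius ≠ 0) : S.frobenius ∉ S.carrier := by
  refine Nat.sSup_mem (s := S.carrierᶜ) ?_ S.cofinite.bddAbove
  by_contra hc
  refine h ?_
  rw [frobenius, Set.not_nonempty_iff_eq_empty.1 hc]
  simp

/-- The Kunz coordinates: the number of gaps in each residue class modulo `m`. -/
noncomputable def kunz (m : ℕ) (v : Fin m) : ℕ := sInf {a | a * m + v ∈ S.carrier}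

section Kunz

open Kunz

variable {S} {m : ℕ} [NeZero m]

theorem kunz_mem (v : Fin m) : S.kunz m v * m + v ∈ S.carrier := by
  obtain ⟨n₀, h⟩ := S.exists_bound
  refine Nat.sInf_mem (s := {a | a * m + v ∈ S.carrier}) ⟨n₀, h _ ?_⟩
  have := Nat.le_mul_of_pos_right n₀ (NeZero.pos m)
  omega

theorem isGap_kunz (hm : m ∈ S.carrier) {n : ℕ} : IsGap (S.kunz m) n ↔ n ∉ S.carrier := by
  have hn : n / m * m + (Fin.ofNat m n : Fin m) = n := by
    simpa [mul_comm] using Nat.div_add_mod n m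
  rw [IsGap, ← not_le, not_iff_not]
  constructor
  · intro h
    refine S.mem_of_modEq hm (kunz_mem (Fin.ofNat m n)) ?_ (by simp)
    conv_rhs => rw [← hn]
    gcongr
  · intro h
    refine Nat.sInf_le ?_
    rw [Set.mem_ofPred_eq, hn]
    exact h

theorem sum_kunz (hm : m ∈ S.carrier) : ∑ v, S.kunz m v = S.genus := by
  have h : S.carrierᶜ = ((univ.sigma fun v => range (S.kunz m v)).image
      fun p : (_ : Fin m) × ℕ => p.2 * m + p.1 : Finset ℕ) := by
    ext n
    rw [Set.mem_compl_iff, ← isGap_kunz hm]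
    simp only [Finset.coe_image, Set.mem_image, Finset.mem_coe, Finset.mem_sigma,
      Finset.mem_univ, true_and, Finset.mem_range, Sigma.exists]
    constructor
    · intro hn
      refine ⟨Fin.ofNat m n, n / m, hn, ?_⟩
      simpa [mul_comm] using Nat.div_add_mod n m
    · rintro ⟨v, a, ha, rfl⟩
      rwa [IsGap, ofNat_mul_add, mul_comm, Nat.mul_add_div (NeZero.pos m),
        Nat.div_eq_of_lt v.isLt, add_zero]
  rw [genus, h, Set.ncard_coe_finset, Finset.card_image_of_injOn, Finset.card_sigma]
  · simp
  · rintro ⟨v, a⟩ - ⟨w, c⟩ - hvw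
    have h1 : v = w := by
      have := congrArg (Fin.ofNat m) hvw
      simpa only [ofNat_mul_add] using this
    subst h1
    have : a = c := by
      simpa [NeZero.ne m] using hvw
    rw [this]

theorem kunz_injective {T : NumericalSemigroup} (hS : m ∈ S.carrier) (hT : m ∈ T.carrier)
    (h : S.kunz m = T.kunz m) : S = T := by
  refine ext_carrier fun n => ?_
  rw [← not_iff_not, ← isGap_kunz hS, ← isGap_kunz hT, h]

theorem isAdmissible_kunz (hm : m = S.multiplicity) : IsAdmissible (S.kunz m) := by
  have hmem : m ∈ S.carrier := hm ▸ S.multiplicity_mem.1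
  refine ⟨fun v hv => ?_, fun f hf v => ?_⟩
  · by_contra! hc
    have h1 := kunz_mem (S := S) v
    rw [show S.kunz m v = 0 by omega, zero_mul, zero_add] at h1
    have := S.multiplicity_le h1 (fun h => hv (Fin.ext h))
    have := v.isLt
    omega
  · by_contra! hc
    rw [isGap_kunz hmem] at hf
    have hadd := S.add_mem (kunz_mem (S := S) v) (kunz_mem (S := S) (reflect m f v))
    have hdm := Nat.div_add_mod f m
    rw [mul_comm] at hdm
    unfold pairBound at hc
    set a := S.kunz m v
    set c := S.kunz m (reflect m f v)
    rcases le_or_gt (v : ℕ) (f % m) with h | h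
    · rw [if_pos h] at hc
      have hr := val_reflect_of_le h
      have e : a * m + v + (c * m + reflect m f v) = (a + c) * m + f % m := by
        rw [add_mul]; omega
      rw [e] at hadd
      refine hf (S.mem_of_modEq hmem hadd ?_ (by simp))
      calc (a + c) * m + f % m ≤ f / m * m + f % m := by gcongr; omega
        _ = f := hdm
    · rw [if_neg h.not_ge] at hc
      have hr := val_reflect_of_lt h
      have e : a * m + v + (c * m + reflect m f v) = (a + c + 1) * m + f % m := by
        have := v.isLt
        rw [add_mul, add_mul]; omega
      rw [e] at hadd
      refine hf (S.mem_of_modEq hmem hadd ?_ (by simp))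
      calc (a + c + 1) * m + f % m ≤ f / m * m + f % m := by gcongr; omega
        _ = f := hdm

end Kunz

theorem multiplicity_le_genus_add_one : S.multiplicity ≤ S.genus + 1 := by
  have : (Finset.Ico 1 S.multiplicity : Set ℕ) ⊆ S.carrierᶜ := by
    intro n hn hc
    simp only [Finset.coe_Ico, Set.mem_Ico] at hn
    have := S.multiplicity_le hc (by omega)
    omega
  have := Set.ncard_le_ncard this S.cofinite
  rw [Set.ncard_coe_finset, Nat.card_Ico] at this
  rw [genus]
  omega

theorem finite_setOf_genus_eq (g : ℕ) : {S : NumericalSemigroup | S.genus = g}.Finite := by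
  refine Set.Finite.of_finite_image (f := fun S => S.carrierᶜ)
    ((Set.finite_Iio ((g + 1) * (g + 1))).finite_subsets.subset ?_) fun S _ T _ h =>
      ext_carrier fun n => by rw [compl_injective h]
  rintro _ ⟨S, rfl, rfl⟩ n hn
  have hm := S.multiplicity_mem
  have : NeZero S.multiplicity := ⟨hm.2⟩
  have h1 := (isGap_kunz hm.1).2 hn
  have h2 : S.kunz S.multiplicity (Fin.ofNat _ n) ≤ S.genus := by
    rw [← sum_kunz hm.1]
    exact Finset.single_le_sum (f := S.kunz S.multiplicity) (fun _ _ => Nat.zero_le _)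
      (Finset.mem_univ _)
  have h3 : n / S.multiplicity < S.genus + 1 := by
    have : n / S.multiplicity < _ := h1
    omega
  rw [Nat.div_lt_iff_lt_mul (NeZero.pos _)] at h3
  exact h3.trans_le (Nat.mul_le_mul_left _ S.multiplicity_le_genus_add_one)

/-- The numerical semigroup with gaps `1, …, a` and `a + 2 + b` for `b ∈ B`, `b < a`. -/
def ofSubset (a : ℕ) (B : Finset ℕ) : NumericalSemigroup where
  carrier := {n | ¬ (1 ≤ n ∧ n ≤ a) ∧ ∀ b ∈ B, b < a → n ≠ a + 2 + b}
  zero_mem := ⟨by omega, fun b _ _ => by omega⟩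
  add_mem := by
    rintro s t ⟨hs1, hs2⟩ ⟨ht1, ht2⟩
    rcases Nat.eq_zero_or_pos s with rfl | hs
    · rw [zero_add]; exact ⟨ht1, ht2⟩
    rcases Nat.eq_zero_or_pos t with rfl | ht
    · exact ⟨hs1, hs2⟩
    · exact ⟨by omega, fun b _ _ => by omega⟩
  cofinite := by
    refine (Set.finite_Iio (2 * a + 2)).subset fun n hn => ?_
    by_contra hc
    simp only [Set.mem_Iio, not_lt] at hc
    exact hn ⟨by omega, fun b _ _ => by omega⟩

theorem genus_ofSubset {a : ℕ} {B : Finset ℕ} (hB : B ⊆ range a) :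
    (ofSubset a B).genus = a + #B := by
  have h : (ofSubset a B).carrierᶜ = (Finset.Icc 1 a ∪ B.map (addLeftEmbedding (a + 2)) :
      Finset ℕ) := by
    ext n
    simp only [ofSubset, Set.mem_compl_iff, Set.mem_ofPred_eq, Finset.coe_union, Set.mem_union,
      Finset.mem_coe, Finset.mem_Icc, Finset.mem_map, addLeftEmbedding_apply]
    constructor
    · intro hn
      by_cases h1 : 1 ≤ n ∧ n ≤ a
      · exact Or.inl h1
      · right
        by_contra! hc
        exact hn ⟨h1, fun b hb _ h => hc b hb h.symm⟩
    · rintro (h | ⟨b, hb, rfl⟩) ⟨h1, h2⟩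
      · exact h1 h
      · exact h2 b hb (Finset.mem_range.1 (hB hb)) rfl
  rw [genus, h, Set.ncard_coe_finset, Finset.card_union_of_disjoint, Finset.card_map,
    Nat.card_Icc, Nat.add_sub_cancel]
  rw [Finset.disjoint_left]
  intro n h1 h2
  simp only [Finset.mem_Icc, Finset.mem_map, addLeftEmbedding_apply] at h1 h2
  obtain ⟨b, -, rfl⟩ := h2
  omega

theorem ofSubset_inj {a a' : ℕ} {B B' : Finset ℕ} (hB : B ⊆ range a) (hB' : B' ⊆ range a')
    (h : ofSubset a B = ofSubset a' B') : a = a' ∧ B = B' := by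
  have hle : ∀ {a a' : ℕ} {B B' : Finset ℕ}, ofSubset a B = ofSubset a' B' → a' ≤ a := by
    intro a a' B B' h
    by_contra! hc
    have h1 : a + 1 ∈ (ofSubset a B).carrier := ⟨by omega, fun b _ _ => by omega⟩
    rw [h] at h1
    exact h1.1 ⟨by omega, by omega⟩
  obtain rfl : a = a' := le_antisymm (hle h.symm) (hle h)
  have hsub : ∀ {B B' : Finset ℕ}, B ⊆ range a → ofSubset a B = ofSubset a B' → B ⊆ B' := by
    intro B B' hB h b hb
    have h1 : a + 2 + b ∉ (ofSubset a B).carrier := fun hc =>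
      hc.2 b hb (Finset.mem_range.1 (hB hb)) rfl
    rw [h] at h1
    by_contra hb'
    refine h1 ⟨by omega, fun c hc _ h => hb' ?_⟩
    rwa [show b = c by omega]
  exact ⟨rfl, (hsub hB h).antisymm (hsub hB' h.symm)⟩

theorem fib_le_ncard (g : ℕ) :
    Nat.fib (g + 1) ≤ {S : NumericalSemigroup | S.genus = g}.ncard := by
  rw [Nat.fib_succ_eq_sum_choose]
  have hc : ∑ p ∈ Finset.HasAntidiagonal.antidiagonal g, p.1.choose p.2 =
      #((Finset.HasAntidiagonal.antidiagonal g).sigma fun p => powersetCard p.2 (range p.1)) := by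
    simp
  rw [hc, ← Set.ncard_coe_finset]
  refine Set.ncard_le_ncard_of_injOn (fun q => ofSubset q.1.1 q.2) (fun q hq => ?_) ?_
    (finite_setOf_genus_eq g)
  · simp only [Finset.mem_coe, Finset.mem_sigma, Finset.HasAntidiagonal.mem_antidiagonal,
      Finset.mem_powersetCard] at hq
    rw [Set.mem_ofPred_eq, genus_ofSubset hq.2.1, hq.2.2, hq.1]
  · rintro ⟨⟨a, b⟩, B⟩ hq ⟨⟨a', b'⟩, B'⟩ hq' h
    simp only [Finset.mem_coe, Finset.mem_sigma, Finset.HasAntidiagonal.mem_antidiagonal,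
      Finset.mem_powersetCard] at hq hq'
    obtain ⟨rfl, rfl⟩ := ofSubset_inj hq.2.1 hq'.2.1 h
    obtain rfl : b = b' := by omega
    rfl

theorem le_fib_mul_pow {x : ℝ} (h0 : 0 < x) (hx : x + x ^ 2 = 1) (g : ℕ) :
    x ≤ Nat.fib (g + 1) * x ^ g := by
  induction g using Nat.twoStepInduction with
  | zero => simp; nlinarith
  | one => simp
  | more g h1 h2 =>
    rw [Nat.fib_add_two]
    push_cast
    calc x = x ^ 2 * x + x * x := by linear_combination (-x) * hx
      _ ≤ x ^ 2 * (Nat.fib (g + 1) * x ^ g) + x * (Nat.fib (g + 1 + 1) * x ^ (g + 1)) := by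
        gcongr
      _ = _ := by ring

/-- The weighted number of semigroups with Frobenius number far from twice the multiplicity
is bounded. -/
theorem exists_sum_pow_genus_le {x : ℝ} (h0 : 0 < x) (hx : x + x ^ 2 = 1) {ε : ℝ} (hε : 0 < ε)
    (hε1 : ε ≤ 1) :
    ∃ C : ℝ, ∀ T : Finset NumericalSemigroup, (∀ S ∈ T,
      ¬ ((2 - ε) * (S.multiplicity : ℝ) < S.frobenius ∧
        (S.frobenius : ℝ) < (2 + ε) * S.multiplicity)) → ∑ S ∈ T, x ^ S.genus ≤ C := by
  classical
  obtain ⟨B, hB, hB0, h⟩ := Kunz.exists_summable_bound h0 hx hε hε1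
  refine ⟨∑' m, B m, fun T hT => ?_⟩
  rw [← Finset.sum_fiberwise_of_maps_to (t := T.image multiplicity) (g := multiplicity)
    (fun S hS => Finset.mem_image_of_mem _ hS)]
  refine le_trans (Finset.sum_le_sum fun m hm => ?_) (hB.sum_le_tsum _ fun m _ => hB0 m)
  obtain ⟨S₀, -, rfl⟩ := Finset.mem_image.1 hm
  set m := S₀.multiplicity with hm0
  have : NeZero m := ⟨S₀.multiplicity_mem.2⟩
  have hmem : ∀ S ∈ ({S ∈ T | S.multiplicity = m} : Finset _), m ∈ S.carrier := fun S hS =>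
    (Finset.mem_filter.1 hS).2 ▸ S.multiplicity_mem.1
  have hsum : ∑ S ∈ T with S.multiplicity = m, x ^ S.genus =
      ∑ k ∈ ({S ∈ T | S.multiplicity = m} : Finset _).image fun S => S.kunz m,
        ∏ v, x ^ k v := by
    rw [Finset.sum_image fun S hS S' hS' e => kunz_injective (hmem S hS) (hmem S' hS') e]
    refine Finset.sum_congr rfl fun S hS => ?_
    rw [Finset.prod_pow_eq_pow_sum, sum_kunz (hmem S hS)]
  rw [hsum]
  refine h m _ (fun k hk => ?_) (fun k hk => ?_)
  · obtain ⟨S, hS, rfl⟩ := Finset.mem_image.1 hk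
    exact isAdmissible_kunz (Finset.mem_filter.1 hS).2.symm
  · obtain ⟨S, hS, rfl⟩ := Finset.mem_image.1 hk
    have hSm := hmem S hS
    obtain ⟨hST, hm⟩ := Finset.mem_filter.1 hS
    have hbad := hT S hST
    rw [hm] at hbad
    have hmpos : (0 : ℝ) < m := by exact_mod_cast NeZero.pos m
    by_cases h1 : (2 - ε) * (m : ℝ) < S.frobenius
    · left
      have h2 : (2 + ε) * (m : ℝ) ≤ S.frobenius := by
        by_contra! hc
        exact hbad ⟨h1, hc⟩
      refine ⟨S.frobenius, (isGap_kunz hSm).2 (S.frobenius_notMem ?_), h2⟩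
      have : (0 : ℝ) < S.frobenius := lt_of_lt_of_le (by positivity) h2
      exact_mod_cast this.ne'
    · right
      intro f hf
      have : (f : ℝ) ≤ S.frobenius := by
        exact_mod_cast S.le_frobenius ((isGap_kunz hSm).1 hf)
      linarith

end NumericalSemigroup

theorem portion_frobenius_near_two_mult (ε₂ : ℝ) (hε₂ : 0 < ε₂) :
    Filter.Tendsto
      (fun g : ℕ =>
        (({S : NumericalSemigroup | S.genus = g ∧
            (2 - ε₂) * (S.multiplicity : ℝ) < (S.frobenius : ℝ) ∧
            (S.frobenius : ℝ) < (2 + ε₂) * (S.multiplicity : ℝ)}.ncard : ℝ)) /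
          ({S : NumericalSemigroup | S.genus = g}.ncard : ℝ))
      Filter.atTop (nhds 1) := by
  classical
  obtain ⟨x, h0, hx⟩ : ∃ x : ℝ, 0 < x ∧ x + x ^ 2 = 1 := by
    have h5 : Real.sqrt 5 ^ 2 = 5 := Real.sq_sqrt (by norm_num)
    refine ⟨(Real.sqrt 5 - 1) / 2, ?_, by linear_combination h5 / 4⟩
    have : 1 < Real.sqrt 5 := by rw [Real.lt_sqrt] <;> norm_num
    linarith
  obtain ⟨C, hC⟩ := NumericalSemigroup.exists_sum_pow_genus_le h0 hx
    (lt_min hε₂ one_pos) (min_le_right ε₂ 1)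
  set good : NumericalSemigroup → Prop := fun S =>
    (2 - ε₂) * (S.multiplicity : ℝ) < S.frobenius ∧
      (S.frobenius : ℝ) < (2 + ε₂) * S.multiplicity with hgood
  have hbad : ∀ S : NumericalSemigroup, ¬ good S →
      ¬ ((2 - min ε₂ 1) * (S.multiplicity : ℝ) < S.frobenius ∧
        (S.frobenius : ℝ) < (2 + min ε₂ 1) * S.multiplicity) := by
    rintro S hS ⟨h1, h2⟩
    have hm : (0 : ℝ) ≤ S.multiplicity := Nat.cast_nonneg _
    have := mul_le_mul_of_nonneg_right (min_le_left ε₂ 1) hm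
    exact hS ⟨by linarith, by linarith⟩
  set A : ℕ → Finset NumericalSemigroup := fun g =>
    (NumericalSemigroup.finite_setOf_genus_eq g).toFinset with hA
  have hmemA : ∀ g S, S ∈ A g ↔ S.genus = g := fun g S => by simp [hA]
  set bad : ℕ → ℝ := fun g => ({S ∈ A g | ¬ good S} : Finset _).card with hbad_def
  have hsummable : Summable fun g => bad g * x ^ g := by
    refine summable_of_sum_range_le (c := C) (fun g => by positivity) fun n => ?_
    have h1 : ∀ g ∈ Finset.range n, bad g * x ^ g = ∑ S ∈ A g with ¬ good S, x ^ S.genus := by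
      intro g _
      rw [Finset.sum_congr rfl fun S hS => by
        rw [(hmemA g S).1 (Finset.mem_filter.1 hS).1], Finset.sum_const, nsmul_eq_mul]
    rw [Finset.sum_congr rfl h1, ← Finset.sum_biUnion]
    · refine hC _ fun S hS => hbad S ?_
      simp only [Finset.mem_biUnion, Finset.mem_filter] at hS
      obtain ⟨_, _, _, h⟩ := hS
      exact h
    · intro g _ g' _ hne
      refine Finset.disjoint_left.2 fun S hS hS' => hne ?_
      rw [← (hmemA g S).1 (Finset.mem_filter.1 hS).1, (hmemA g' S).1 (Finset.mem_filter.1 hS').1]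
  have hcard : ∀ g, ({S : NumericalSemigroup | S.genus = g}.ncard : ℝ) = (A g).card := fun g => by
    rw [Set.ncard_eq_toFinset_card _ (NumericalSemigroup.finite_setOf_genus_eq g)]
  have hlower : ∀ g, x ≤ (A g).card * x ^ g := by
    intro g
    refine (NumericalSemigroup.le_fib_mul_pow h0 hx g).trans ?_
    rw [← hcard]
    gcongr
    exact NumericalSemigroup.fib_le_ncard g
  have hpos : ∀ g, (0 : ℝ) < (A g).card := fun g =>
    pos_of_mul_pos_left (h0.trans_le (hlower g)) (by positivity)
  have hlim : Filter.Tendsto (fun g => 1 - bad g / (A g).card) Filter.atTop (nhds 1) := by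
    rw [show nhds (1 : ℝ) = nhds (1 - 0) by rw [sub_zero]]
    refine tendsto_const_nhds.sub (squeeze_zero (fun g => by positivity) (fun g => ?_)
      (by simpa using hsummable.tendsto_atTop_zero.div_const x))
    rw [div_le_div_iff₀ (hpos g) h0]
    calc bad g * x ≤ bad g * ((A g).card * x ^ g) := by gcongr; exact hlower g
      _ = _ := by ring
  refine hlim.congr fun g => ?_
  have hg : ({S : NumericalSemigroup | S.genus = g ∧ good S}.ncard : ℝ) =
      ({S ∈ A g | good S} : Finset _).card := by
    rw [← Set.ncard_coe_finset]
    congr 2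
    ext S
    simp [hmemA]
  change _ = ({S : NumericalSemigroup | S.genus = g ∧ good S}.ncard : ℝ) / _
  rw [hg, hcard, eq_div_iff (hpos g).ne', sub_mul, div_mul_cancel₀ _ (hpos g).ne', one_mul,
    sub_eq_iff_eq_add]
  simp only [hbad_def]
  exact_mod_cast (Finset.card_filter_add_card_filter_not (s := A g) good).symm
end
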